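/- arXiv:2507.05567 — 10 statements merged into one kernel-verified Lean document; each statement's English description precedes it below -/
import Mathlib

section
/- Let q be a prime power and let s, t be nonnegative integers with s + t > 0 and t < q. Then every [s(q+1)+t+1, 2, sq+t]_q linear code C satisfies A_{sq+t}(C) ≥ (q−1)(t+1), i.e., C has at least (q−1)(t+1) codewords of minimum weight sq+t. -/
/-- The number of codewords of the linear code `C` of Hamming weight `i`. -/
noncomputable def wtCount {F : Type*} [Field F] [DecidableEq F] {ι : Type*} [Fintype ι]
    (C : Submodule F (ι → F)) (i : ℕ) : ℕ :=
  Set.ncard {c : ι → F | c ∈ C ∧ hammingNorm c = i}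

/-- The linear code `C` has minimum Hamming distance exactly `d`. -/
def minDistIs {F : Type*} [Field F] [DecidableEq F] {ι : Type*} [Fintype ι]
    (C : Submodule F (ι → F)) (d : ℕ) : Prop :=
  (∃ c ∈ C, c ≠ 0 ∧ hammingNorm c = d) ∧ ∀ c ∈ C, c ≠ 0 → d ≤ hammingNorm c

lemma coord_count {F : Type*} [Field F] [Fintype F] [DecidableEq F] {ι : Type*} [Fintype ι]
    (C : Submodule F (ι → F)) [Fintype C] (hdim : Module.finrank F C = 2) (i : ι) :
    (Finset.univ.filter (fun c : C => c.1 i ≠ 0)).card + Fintype.card F ≤ Fintype.card F ^ 2 := by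
  classical
  have hcard : Fintype.card C = Fintype.card F ^ 2 := by
    rw [Module.card_eq_pow_finrank (K := F) (V := C), hdim]
  let f : C →ₗ[F] F := (LinearMap.proj i).comp C.subtype
  have h1 := f.finrank_range_add_finrank_ker
  have h2 : Module.finrank F (LinearMap.range f) ≤ 1 := by
    simpa using Submodule.finrank_le (LinearMap.range f)
  have h3 : 1 ≤ Module.finrank F (LinearMap.ker f) := by omega
  have h4 : Fintype.card F ≤ Fintype.card (LinearMap.ker f) := by
    rw [Module.card_eq_pow_finrank (K := F) (V := LinearMap.ker f)]
    exact Nat.le_self_pow (by omega) _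
  have h5 : Fintype.card (LinearMap.ker f) = (Finset.univ.filter (fun c : C => c.1 i = 0)).card := by
    apply Fintype.card_of_subtype
    intro x
    simp [f]
  have h6 := Finset.card_filter_add_card_filter_not (s := (Finset.univ : Finset C))
    (fun c : C => c.1 i = 0)
  rw [Finset.card_univ, hcard] at h6
  simp only [ne_eq]
  omega

/-- every `[s(q+1)+t+1, 2, sq+t]_q` linear code has at least
`(q-1)(t+1)` codewords of minimum weight `sq+t`. -/
theorem stmt_0 {F : Type*} [Field F] [Fintype F] [DecidableEq F]
    (s t : ℕ) (hst : 0 < s + t) (ht : t < Fintype.card F)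
    (C : Submodule F (Fin (s * (Fintype.card F + 1) + t + 1) → F))
    (hdim : Module.finrank F C = 2)
    (hdist : minDistIs C (s * Fintype.card F + t)) :
    (Fintype.card F - 1) * (t + 1) ≤ wtCount C (s * Fintype.card F + t) := by
  classical
  have : Fintype C := Fintype.ofFinite C
  have hcard : Fintype.card C = Fintype.card F ^ 2 := by
    rw [Module.card_eq_pow_finrank (K := F) (V := C), hdim]
  have hco := coord_count C hdim
  have hmin := hdist.2
  generalize hd : s * Fintype.card F + t = d at *
  set S : Finset C := Finset.univ.erase 0 with hS
  have hScard : S.card + 1 = Fintype.card F ^ 2 := by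
    have e := Finset.card_erase_add_one (Finset.mem_univ (0 : C))
    exact (e.trans Finset.card_univ).trans hcard
  set A := S.filter (fun c => hammingNorm c.1 = d) with hA
  set B := S.filter (fun c => ¬ hammingNorm c.1 = d) with hB
  have hAB : A.card + B.card = S.card := Finset.card_filter_add_card_filter_not _
  have hAle : A.card ≤ wtCount C d := by
    unfold wtCount
    rw [← Set.ncard_coe_finset, ← Set.ncard_image_of_injective _ Subtype.val_injective]
    apply Set.ncard_le_ncard _ (Set.toFinite _)
    rintro _ ⟨c, hc, rfl⟩
    simp only [hA, Finset.coe_filter, Set.mem_ofPred_eq] at hc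
    exact ⟨c.2, hc.2⟩
  have hlow : d * S.card + B.card ≤ ∑ c ∈ S, hammingNorm c.1 := by
    rw [hB, Finset.card_filter, mul_comm, ← smul_eq_mul, ← Finset.sum_const,
      ← Finset.sum_add_distrib]
    apply Finset.sum_le_sum
    intro c hc
    have := hmin c.1 c.2 (by
      have := Finset.ne_of_mem_erase hc
      simpa using this)
    split_ifs <;> omega
  have hup : ∑ c ∈ S, hammingNorm c.1 + (s * (Fintype.card F + 1) + t + 1) * Fintype.card F
      ≤ (s * (Fintype.card F + 1) + t + 1) * Fintype.card F ^ 2 := by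
    have e1 : ∑ c ∈ S, hammingNorm c.1 ≤ ∑ c : C, hammingNorm c.1 :=
      Finset.sum_le_sum_of_subset (Finset.subset_univ _)
    have e2 : ∑ c : C, hammingNorm c.1 =
        ∑ i, (Finset.univ.filter (fun c : C => c.1 i ≠ 0)).card := by
      simp only [hammingNorm, Finset.card_filter]
      exact Finset.sum_comm
    have e3 := Finset.sum_le_sum (fun i (_ : i ∈ Finset.univ) => hco i)
    rw [Finset.sum_add_distrib, ← e2] at e3
    simp only [Finset.sum_const, Finset.card_univ, Fintype.card_fin, smul_eq_mul] at e3
    omega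
  refine le_trans ?_ hAle
  clear_value A B S
  generalize Fintype.card F = q at *
  obtain ⟨r, rfl⟩ : ∃ r, q = r + 1 := ⟨q - 1, by omega⟩
  subst hd
  have h' := (Nat.add_le_add_right hlow _).trans hup
  simp only [Nat.add_sub_cancel]
  clear hup hlow hAle hmin hdist hA hB hco hcard hS
  zify at *
  have hSe : (S.card : ℤ) = (r + 1) ^ 2 - 1 := by linarith
  rw [hSe] at h' hAB
  nlinarith
end

section
/- Let q be a prime power and let s, t be nonnegative integers with s + t > 0 and t < q. Then d(s(q+1)+t+1, 2, q) = sq + t (i.e., sq+t is the largest possible minimum distance of a linear code of length s(q+1)+t+1 and dimension 2 over 𝔽_q), and there exists an [s(q+1)+t+1, 2, sq+t]_q linear code with exactly (q−1)(t+1) codewords of weight sq+t; consequently e(s(q+1)+t+1, 2, q) = (q−1)(t+1). -/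
/-- `dOpt F n k` is the largest minimum distance among `[n,k]` linear codes over `F`. -/
noncomputable def dOpt (F : Type*) [Field F] [Fintype F] [DecidableEq F] (n k : ℕ) : ℕ :=
  sSup {d | ∃ C : Submodule F (Fin n → F), Module.finrank F C = k ∧ minDistIs C d}

/-- `eOpt F n k` is the smallest error coefficient among distance-optimal `[n,k]` codes. -/
noncomputable def eOpt (F : Type*) [Field F] [Fintype F] [DecidableEq F] (n k : ℕ) : ℕ :=
  sInf {e | ∃ C : Submodule F (Fin n → F), Module.finrank F C = k ∧
    minDistIs C (dOpt F n k) ∧ wtCount C (dOpt F n k) = e}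

theorem wtCount_eq_card {F : Type*} [Field F] [Fintype F] [DecidableEq F] {ι : Type*} [Fintype ι]
    (C : Submodule F (ι → F)) [Fintype C] (d : ℕ) :
    wtCount C d = (Finset.univ.filter fun c : C => hammingNorm (c : ι → F) = d).card := by
  unfold wtCount
  have : {c : ι → F | c ∈ C ∧ hammingNorm c = d} =
      Set.image Subtype.val {c : C | hammingNorm (c : ι → F) = d} := by
    ext c
    simp [and_comm]
  rw [this, Set.ncard_image_of_injective _ Subtype.val_injective, ← Set.ncard_coe_finset]
  simp

theorem card_coord {F : Type*} [Field F] [Fintype F] [DecidableEq F] {ι : Type*} [Fintype ι]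
    (C : Submodule F (ι → F)) [Fintype C] (hC : Module.finrank F C = 2) (i : ι) :
    (Finset.univ.filter fun c : C => (c : ι → F) i ≠ 0).card + Fintype.card F
      ≤ Fintype.card F ^ 2 := by
  classical
  let f : C →ₗ[F] F := (LinearMap.proj i).comp C.subtype
  have h1 := LinearMap.finrank_range_add_finrank_ker f
  have h2 : Module.finrank F (LinearMap.range f) ≤ 1 := by
    simpa using Submodule.finrank_le (LinearMap.range f)
  have h3 : 1 ≤ Module.finrank F (LinearMap.ker f) := by omega
  have h4 : Nat.card (LinearMap.ker f) = Fintype.card F ^ Module.finrank F (LinearMap.ker f) := by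
    rw [Module.natCard_eq_pow_finrank (K := F), Nat.card_eq_fintype_card]
  have h5 : Fintype.card C = Fintype.card F ^ 2 := by
    rw [Module.card_eq_pow_finrank (K := F), hC]
  have h6 : Fintype.card F ≤ Nat.card (LinearMap.ker f) := by
    rw [h4]
    exact Nat.le_self_pow (by omega) _
  have h7 : Nat.card (LinearMap.ker f) =
      (Finset.univ.filter fun c : C => (c : ι → F) i = 0).card := by
    rw [Nat.subtype_card]
    intro c
    simp [f]
  have h8 := Finset.card_filter_add_card_filter_not (s := (Finset.univ : Finset C))
    (fun c : C => (c : ι → F) i = 0)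
  rw [Finset.card_univ, h5] at h8
  simp only [ne_eq]
  omega

theorem sum_wt_le {F : Type*} [Field F] [Fintype F] [DecidableEq F] {ι : Type*} [Fintype ι]
    (C : Submodule F (ι → F)) [Fintype C] (hC : Module.finrank F C = 2) :
    ∑ c : C, hammingNorm (c : ι → F) + Fintype.card ι * Fintype.card F
      ≤ Fintype.card ι * Fintype.card F ^ 2 := by
  have h : ∑ c : C, hammingNorm (c : ι → F) =
      ∑ i : ι, (Finset.univ.filter fun c : C => (c : ι → F) i ≠ 0).card := by
    simp only [hammingNorm, Finset.card_filter]
    exact Finset.sum_comm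
  have h2 := Finset.sum_le_sum (s := (Finset.univ : Finset ι)) fun i _ => card_coord C hC i
  rw [Finset.sum_add_distrib, ← h] at h2
  simpa using h2

theorem count_lower {F : Type*} [Field F] [Fintype F] [DecidableEq F] (s t : ℕ)
    (C : Submodule F (Fin (s * (Fintype.card F + 1) + t + 1) → F))
    (hC : Module.finrank F C = 2)
    (hd : ∀ c ∈ C, c ≠ 0 → s * Fintype.card F + t ≤ hammingNorm c) :
    (Fintype.card F - 1) * (t + 1) ≤ wtCount C (s * Fintype.card F + t) := by
  classical
  have : Fintype C := Fintype.ofFinite C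
  rw [wtCount_eq_card]
  have h1 := sum_wt_le C hC
  have h5 : Fintype.card C = Fintype.card F ^ 2 := by
    rw [Module.card_eq_pow_finrank (K := F), hC]
  have h2 : ∑ c : C, (s * Fintype.card F + t + 1) ≤
      ∑ c : C, (hammingNorm (c : Fin (s * (Fintype.card F + 1) + t + 1) → F) +
        (if hammingNorm (c : Fin (s * (Fintype.card F + 1) + t + 1) → F) = s * Fintype.card F + t then 1 else 0) +
        (if c = 0 then (s * Fintype.card F + t + 1) else 0)) := by
    apply Finset.sum_le_sum
    intro c _
    by_cases h : c = 0
    · rw [if_pos h]; omega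
    · have := hd c c.2 (by simpa using h)
      split_ifs <;> omega
  rw [Finset.sum_const, Finset.card_univ, h5, Finset.sum_add_distrib, Finset.sum_add_distrib,
    ← Finset.card_filter] at h2
  simp only [Finset.sum_ite_eq', Finset.mem_univ, if_true, smul_eq_mul, Fintype.card_fin] at h1 h2
  have hq : 1 ≤ Fintype.card F := Fintype.card_pos
  generalize (Finset.univ.filter fun c : C =>
    hammingNorm (c : Fin (s * (Fintype.card F + 1) + t + 1) → F) = s * Fintype.card F + t).card = A at *
  generalize ∑ c : C, hammingNorm (c : Fin (s * (Fintype.card F + 1) + t + 1) → F) = S at *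
  generalize Fintype.card F = q at *
  zify [hq] at *
  nlinarith

/-- evaluation of the functional `(a, b)` at a point of the projective line -/
def evPt {F : Type*} [Field F] (v : F × F) : Option F → F
  | some x => v.1 + v.2 * x
  | none => v.2

def rootVec {F : Type*} [Field F] : Option F → F × F
  | some x => (-x, 1)
  | none => (1, 0)

theorem evPt_zero {F : Type*} [Field F] (v : F × F) (hv : v ≠ 0) (p : Option F)
    (h : evPt v p = 0) : ∃ u : Fˣ, v = (u : F) • rootVec p := by
  obtain ⟨a, b⟩ := v
  cases p with
  | none =>
    simp only [evPt] at h
    subst h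
    have ha : a ≠ 0 := by
      rintro rfl
      exact hv rfl
    exact ⟨Units.mk0 a ha, by simp [rootVec]⟩
  | some x =>
    simp only [evPt] at h
    have ha : a = -(b * x) := by linear_combination h
    have hb : b ≠ 0 := by
      rintro rfl
      exact hv (by simp [ha])
    exact ⟨Units.mk0 b hb, by simp [rootVec, ha]⟩

theorem evPt_unique {F : Type*} [Field F] (v : F × F) (hv : v ≠ 0) (p p' : Option F)
    (h : evPt v p = 0) (h' : evPt v p' = 0) : p = p' := by
  obtain ⟨u, rfl⟩ := evPt_zero v hv p h
  cases p <;> cases p' <;> simp [evPt, rootVec] at *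
  rename_i x y
  have : (u : F) * (y - x) = 0 := by linear_combination h'
  rcases mul_eq_zero.1 this with h | h
  · exact absurd h u.ne_zero
  · exact (sub_eq_zero.1 h).symm

/-- the encoder attached to a family of points -/
def enc {F : Type*} [Field F] {ι : Type*} (pt : ι → Option F) : F × F →ₗ[F] (ι → F) where
  toFun v i := evPt v (pt i)
  map_add' v w := by
    funext i
    cases h : pt i <;> simp [evPt, h]
    ring
  map_smul' r v := by
    funext i
    cases h : pt i <;> simp [evPt, h]
    ring

theorem exists_code {F : Type*} [Field F] [Fintype F] [DecidableEq F]
    (s t : ℕ) (hst : 0 < s + t) (ht : t < Fintype.card F) :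
    ∃ C : Submodule F (Fin (s * (Fintype.card F + 1) + t + 1) → F),
      Module.finrank F C = 2 ∧ (∀ c ∈ C, c ≠ 0 → s * Fintype.card F + t ≤ hammingNorm c) ∧
      wtCount C (s * Fintype.card F + t) ≤ (Fintype.card F - 1) * (t + 1) := by
  classical
  obtain ⟨g⟩ : Nonempty (Fin (t + 1) ↪ Option F) := by
    apply Function.Embedding.nonempty_of_card_le
    simp
    omega
  have hcard : Fintype.card ((Fin s × Option F) ⊕ Fin (t + 1)) =
      Fintype.card (Fin (s * (Fintype.card F + 1) + t + 1)) := by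
    simp [add_assoc]
  let e := (Fintype.equivOfCardEq hcard).symm
  let pt0 : (Fin s × Option F) ⊕ Fin (t + 1) → Option F := Sum.elim Prod.snd g
  let φ := enc (F := F) (fun i => pt0 (e i))
  -- weight computation
  have hwt : ∀ v : F × F, v ≠ 0 → ∃ z : ℕ, hammingNorm (φ v) + (s + z) =
      s * (Fintype.card F + 1) + t + 1 ∧ z ≤ 1 ∧ (z = 1 → ∃ j, evPt v (g j) = 0) := by
    intro v hv
    refine ⟨(Finset.univ.filter fun j => evPt v (g j) = 0).card, ?_, ?_, ?_⟩
    · have h1 := Finset.card_filter_add_card_filter_not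
        (s := (Finset.univ : Finset (Fin (s * (Fintype.card F + 1) + t + 1))))
        (fun i => φ v i = 0)
      have h2 : (Finset.univ.filter fun i => φ v i = 0).card =
          (Finset.univ.filter fun x => evPt v (pt0 x) = 0).card := by
        apply Finset.card_equiv e
        intro i
        simp [φ, enc]
      have h3 : (Finset.univ.filter fun x => evPt v (pt0 x) = 0).card =
          s + (Finset.univ.filter fun j => evPt v (g j) = 0).card := by
        have hex : ∃ p, evPt v p = 0 := by
          by_cases hb : v.2 = 0
          · exact ⟨none, hb⟩
          · exact ⟨some (-v.1 / v.2), by simp only [evPt]; field_simp; ring⟩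
        obtain ⟨p, hp⟩ := hex
        have hiff : ∀ p', evPt v p' = 0 ↔ p' = p := fun p' =>
          ⟨fun h => evPt_unique v hv _ _ h hp, fun h => h ▸ hp⟩
        simp only [hiff]
        rw [Finset.card_filter, Fintype.sum_sum_type, Fintype.sum_prod_type, Finset.card_filter]
        simp only [pt0, Sum.elim_inl, Sum.elim_inr]
        cases p <;> simp [-Finset.sum_boole] <;> congr!
      rw [h2, h3] at h1
      simp only [Finset.card_univ, Fintype.card_fin] at h1
      unfold hammingNorm
      simp only [ne_eq]
      omega
    · rw [Finset.card_le_one]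
      intro a ha b hb
      simp only [Finset.mem_filter, Finset.mem_univ, true_and] at ha hb
      exact g.injective (evPt_unique v hv _ _ ha hb)
    · intro h
      obtain ⟨j, hj⟩ := Finset.card_pos.1 (by omega :
        0 < (Finset.univ.filter fun j => evPt v (g j) = 0).card)
      exact ⟨j, by simpa using hj⟩
  have hq : 1 ≤ Fintype.card F := Fintype.card_pos
  have hpos : 0 < s * Fintype.card F + t := by
    rcases Nat.eq_zero_or_pos s with h | h
    · omega
    · have := Nat.mul_pos h hq
      omega
  have hexp : s * (Fintype.card F + 1) = s * Fintype.card F + s := by ring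
  have hinj : Function.Injective φ := by
    rw [injective_iff_map_eq_zero]
    intro v h
    by_contra hv
    obtain ⟨z, h1, h2, -⟩ := hwt v hv
    rw [h, hammingNorm_zero] at h1
    omega
  refine ⟨LinearMap.range φ, ?_, ?_, ?_⟩
  · rw [LinearMap.finrank_range_of_inj hinj]
    simp
  · rintro _ ⟨v, rfl⟩ hc
    have hv : v ≠ 0 := by
      rintro rfl
      exact hc (map_zero _)
    obtain ⟨z, h1, h2, -⟩ := hwt v hv
    omega
  · have hsub : {c | c ∈ LinearMap.range φ ∧ hammingNorm c = s * Fintype.card F + t} ⊆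
        Set.range (fun x : Fˣ × Fin (t + 1) => φ ((x.1 : F) • rootVec (g x.2))) := by
      rintro _ ⟨⟨v, rfl⟩, hc⟩
      have hv : v ≠ 0 := by
        rintro rfl
        rw [map_zero, hammingNorm_zero] at hc
        omega
      obtain ⟨z, h1, h2, h3⟩ := hwt v hv
      obtain ⟨j, hj⟩ := h3 (by omega)
      obtain ⟨u, hu⟩ := evPt_zero v hv _ hj
      exact ⟨(u, j), by simp only [← hu]⟩
    unfold wtCount
    refine (Set.ncard_le_ncard hsub (Set.toFinite _)).trans ?_
    rw [← Set.image_univ]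
    refine (Set.ncard_image_le (Set.toFinite _)).trans ?_
    rw [Set.ncard_univ, Nat.card_eq_fintype_card, Fintype.card_prod, Fintype.card_units,
      Fintype.card_fin]

/-- `d(s(q+1)+t+1, 2, q) = sq+t`, there exists an `[s(q+1)+t+1,2,sq+t]_q`
code with exactly `(q-1)(t+1)` minimum-weight codewords, and
`e(s(q+1)+t+1, 2, q) = (q-1)(t+1)`. -/
theorem stmt_1 {F : Type*} [Field F] [Fintype F] [DecidableEq F]
    (s t : ℕ) (hst : 0 < s + t) (ht : t < Fintype.card F) :
    dOpt F (s * (Fintype.card F + 1) + t + 1) 2 = s * Fintype.card F + t ∧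
    (∃ C : Submodule F (Fin (s * (Fintype.card F + 1) + t + 1) → F),
      Module.finrank F C = 2 ∧ minDistIs C (s * Fintype.card F + t) ∧
      wtCount C (s * Fintype.card F + t) = (Fintype.card F - 1) * (t + 1)) ∧
    eOpt F (s * (Fintype.card F + 1) + t + 1) 2 = (Fintype.card F - 1) * (t + 1) := by
  have hq : 2 ≤ Fintype.card F := Fintype.one_lt_card
  have hpos : 0 < s * Fintype.card F + t := by
    rcases Nat.eq_zero_or_pos s with h | h
    · omega
    · have := Nat.mul_pos h (by omega : 0 < Fintype.card F)
      omega
  have hA : 0 < (Fintype.card F - 1) * (t + 1) := Nat.mul_pos (by omega) (by omega)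
  have hmin : ∀ C : Submodule F (Fin (s * (Fintype.card F + 1) + t + 1) → F),
      Module.finrank F C = 2 → (∀ c ∈ C, c ≠ 0 → s * Fintype.card F + t ≤ hammingNorm c) →
      ∃ c ∈ C, c ≠ 0 ∧ hammingNorm c = s * Fintype.card F + t := by
    intro C h1 h2
    have h3 := count_lower s t C h1 h2
    obtain ⟨c, hc, hw⟩ := Set.nonempty_of_ncard_ne_zero
      (show Set.ncard {c | c ∈ C ∧ hammingNorm c = s * Fintype.card F + t} ≠ 0 by
        unfold wtCount at h3; omega)
    refine ⟨c, hc, ?_, hw⟩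
    rintro rfl
    rw [hammingNorm_zero] at hw
    omega
  obtain ⟨C, hC, hlow, hup⟩ := exists_code (F := F) s t hst ht
  have hmd : minDistIs C (s * Fintype.card F + t) := ⟨hmin C hC hlow, hlow⟩
  have hcnt := le_antisymm hup (count_lower s t C hC hlow)
  have hd : dOpt F (s * (Fintype.card F + 1) + t + 1) 2 = s * Fintype.card F + t := by
    have : IsGreatest {d | ∃ C : Submodule F (Fin (s * (Fintype.card F + 1) + t + 1) → F),
        Module.finrank F C = 2 ∧ minDistIs C d} (s * Fintype.card F + t) := by
      refine ⟨⟨C, hC, hmd⟩, ?_⟩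
      rintro d ⟨C', h1, -, h2⟩
      by_contra hlt
      obtain ⟨c, hc, h0, hw⟩ := hmin C' h1 fun c hc h0 => by
        have := h2 c hc h0
        omega
      have := h2 c hc h0
      omega
    exact this.csSup_eq
  refine ⟨hd, ⟨C, hC, hmd, hcnt⟩, ?_⟩
  unfold eOpt
  rw [hd]
  have : IsLeast {e | ∃ C : Submodule F (Fin (s * (Fintype.card F + 1) + t + 1) → F),
      Module.finrank F C = 2 ∧ minDistIs C (s * Fintype.card F + t) ∧
      wtCount C (s * Fintype.card F + t) = e} ((Fintype.card F - 1) * (t + 1)) := by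
    refine ⟨⟨C, hC, hmd, hcnt⟩, ?_⟩
    rintro _ ⟨C', h1, h2, rfl⟩
    exact count_lower s t C' h1 h2.2
  exact this.csInf_eq
end

section
/- Let C be an [n,k,d]_q linear code with k ≥ 3. Set t = q if q divides d, and t = d mod q otherwise. Then A_d(C) ≥ t · e_{⌈d/q⌉}(n−d, k−1, q) + (q−1). -/
/-- `eD F n k d` is the smallest number of weight-`d` codewords among all `[n,k]`
linear codes over `F` with minimum distance at least `d`. -/
noncomputable def eD (F : Type*) [Field F] [Fintype F] [DecidableEq F] (n k d : ℕ) : ℕ :=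
  sInf {e | ∃ C : Submodule F (Fin n → F), Module.finrank F C = k ∧
    (∀ c ∈ C, c ≠ 0 → d ≤ hammingNorm c) ∧ wtCount C d = e}

open Finset in
/-- Sum of the weights over the coset line `x - a c`. -/
theorem sum_weights {F : Type*} [Field F] [Fintype F] [DecidableEq F] {n : ℕ}
    (x c : Fin n → F) :
    ∑ a : F, hammingNorm (x - a • c) =
      Fintype.card F * (univ.filter (fun i => c i = 0 ∧ x i ≠ 0)).card
        + (Fintype.card F - 1) * hammingNorm c := by
  have h1 : ∀ i, (∑ a : F, if (x - a • c) i ≠ 0 then 1 else 0) =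
      Fintype.card F * (if c i = 0 ∧ x i ≠ 0 then 1 else 0)
        + (Fintype.card F - 1) * (if c i ≠ 0 then 1 else 0) := by
    intro i
    by_cases hc : c i = 0
    · by_cases hx : x i = 0 <;> simp [hc, hx]
    · have : (univ.filter (fun a : F => (x - a • c) i ≠ 0)) = univ.erase (x i / c i) := by
        ext a
        simp only [Pi.sub_apply, Pi.smul_apply, smul_eq_mul, mem_filter, mem_univ, true_and,
          mem_erase, and_true, ne_eq]
        rw [sub_eq_zero, eq_div_iff hc, eq_comm]
      rw [← Finset.card_filter, this, card_erase_of_mem (mem_univ _)]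
      simp [hc]
  simp only [hammingNorm, Finset.card_filter]
  rw [Finset.sum_comm, Finset.mul_sum, Finset.mul_sum, ← Finset.sum_add_distrib]
  exact Finset.sum_congr rfl (fun i _ => h1 i)

open Finset in
/-- If the average is small, many terms attain the lower bound. -/
theorem many_min {F : Type*} [Fintype F] (f : F → ℕ) (d s : ℕ) (hf : ∀ a, d ≤ f a)
    (hs : ∑ a, f a = Fintype.card F * d + s) :
    Fintype.card F ≤ (univ.filter (fun a => f a = d)).card + s := by
  have h1 : ∑ a : F, (d + 1) ≤ ∑ a : F, (f a + if f a = d then 1 else 0) := by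
    apply Finset.sum_le_sum
    intro a _
    have := hf a
    split_ifs <;> omega
  rw [Finset.sum_add_distrib, Finset.sum_add_distrib, hs, ← Finset.card_filter] at h1
  simp at h1
  omega

open Finset in
theorem stmt_3 {F : Type*} [Field F] [Fintype F] [DecidableEq F]
    (n k d : ℕ) (hk : 3 ≤ k)
    (C : Submodule F (Fin n → F))
    (hdim : Module.finrank F C = k)
    (hdist : minDistIs C d)
    (t : ℕ)
    (htdef : t = if Fintype.card F ∣ d then Fintype.card F else d % Fintype.card F) :
    t * eD F (n - d) (k - 1) ((d + Fintype.card F - 1) / Fintype.card F)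
      + (Fintype.card F - 1) ≤ wtCount C d := by
  classical
  obtain ⟨⟨c, hcC, hc0, hcd⟩, hmin⟩ := hdist
  have hd : 0 < d := by rw [← hcd]; exact hammingNorm_pos_iff.2 hc0
  set q := Fintype.card F with hq
  have hq2 : 1 < q := Fintype.one_lt_card
  set m := (d + q - 1) / q with hm
  -- arithmetic facts
  have hmq : q * m + t = d + q := by
    have hdm := Nat.div_add_mod d q
    have hlt := Nat.mod_lt d (show 0 < q by omega)
    split_ifs at htdef with hdvd
    · obtain ⟨r, hr⟩ := hdvd
      have : m = r := by
        rw [hm, hr, show q * r + q - 1 = (q - 1) + q * r by omega,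
          Nat.add_mul_div_left _ _ (by omega), Nat.div_eq_of_lt (by omega), zero_add]
      rw [this, htdef, hr]
    · have h0 : d % q ≠ 0 := fun h => hdvd (Nat.dvd_of_mod_eq_zero h)
      have : m = d / q + 1 := by
        rw [hm, show d + q - 1 = (d % q - 1) + q * (d / q + 1) by rw [mul_add]; omega,
          Nat.add_mul_div_left _ _ (by omega), Nat.div_eq_of_lt (by omega), zero_add]
      rw [this, htdef, mul_add]; omega
  have htq : t ≤ q := by
    split_ifs at htdef with hdvd
    · omega
    · rw [htdef]; exact (Nat.mod_lt _ (by omega)).le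
  have hm0 : 0 < m := Nat.div_pos (by omega) (by omega)
  -- the residual code
  have hcard : Fintype.card {i // c i = 0} = n - d := by
    have h := Fintype.card_subtype_compl (fun i => c i ≠ 0)
    simp only [not_not, Fintype.card_fin] at h
    rw [h, Fintype.card_subtype, ← hcd]; rfl
  let e : Fin (n - d) ≃ {i // c i = 0} := (Fintype.equivFinOfCardEq hcard).symm
  let φ : (Fin n → F) →ₗ[F] (Fin (n - d) → F) := LinearMap.funLeft F F (fun j => (e j).1)
  have hφ : ∀ x j, φ x j = x (e j).1 := fun x j => rfl
  have hφw : ∀ x, hammingNorm (φ x) = (univ.filter (fun i => c i = 0 ∧ x i ≠ 0)).card := by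
    intro x
    unfold hammingNorm
    apply Finset.card_bij (fun j _ => (e j).1)
    · intro j hj
      simp only [mem_filter, mem_univ, true_and, hφ] at hj ⊢
      exact ⟨(e j).2, hj⟩
    · intro a _ b _ h
      exact e.injective (Subtype.ext h)
    · intro i hi
      simp only [mem_filter, mem_univ, true_and] at hi
      exact ⟨e.symm ⟨i, hi.1⟩, by simp [hφ, hi.2], by simp⟩
  have hφc : φ c = 0 := by
    ext j; rw [hφ]; exact (e j).2
  have hsum : ∀ x, ∑ a : F, hammingNorm (x - a • c) = q * hammingNorm (φ x) + (q - 1) * d := by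
    intro x; rw [sum_weights, hφw, hcd]
  have hge : ∀ x ∈ C, x ∉ Submodule.span F {c} → ∀ a : F, d ≤ hammingNorm (x - a • c) := by
    intro x hx hxc a
    apply hmin _ (C.sub_mem hx (C.smul_mem _ hcC))
    intro h
    exact hxc (Submodule.mem_span_singleton.2 ⟨a, (sub_eq_zero.1 h).symm⟩)
  have hqd : (q - 1) * d + d = q * d := by
    obtain ⟨r, hr⟩ : ∃ r, q = r + 1 := ⟨q - 1, by omega⟩
    rw [hr]; simp; ring
  have hres : ∀ x ∈ C, x ∉ Submodule.span F {c} → m ≤ hammingNorm (φ x) := by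
    intro x hx hxc
    have h1 : ∑ a : F, d ≤ ∑ a : F, hammingNorm (x - a • c) :=
      Finset.sum_le_sum (fun a _ => hge x hx hxc a)
    rw [hsum] at h1
    simp only [sum_const, card_univ, smul_eq_mul, ← hq] at h1
    have h2 : d ≤ q * hammingNorm (φ x) := by omega
    by_contra hlt
    push Not at hlt
    have h3 : q * (hammingNorm (φ x) + 1) ≤ q * m := Nat.mul_le_mul_left _ hlt
    rw [mul_add] at h3
    have ht1 : 0 < t := by
      split_ifs at htdef with hdvd
      · omega
      · have h0 : d % q ≠ 0 := fun h => hdvd (Nat.dvd_of_mod_eq_zero h)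
        omega
    omega
  have hspan : ∀ x ∈ Submodule.span F {c}, φ x = 0 := by
    intro x hx
    obtain ⟨a, rfl⟩ := Submodule.mem_span_singleton.1 hx
    rw [map_smul, hφc, smul_zero]
  -- dimension
  have hker : LinearMap.ker (φ.domRestrict C) = Submodule.span F {(⟨c, hcC⟩ : C)} := by
    ext x
    rw [LinearMap.mem_ker, LinearMap.domRestrict_apply, Submodule.mem_span_singleton]
    constructor
    · intro h
      by_contra hx
      have := hres x.1 x.2 (fun h' => hx (by
        obtain ⟨a, ha⟩ := Submodule.mem_span_singleton.1 h'
        exact ⟨a, Subtype.ext ha⟩))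
      rw [h, hammingNorm_zero] at this
      omega
    · rintro ⟨a, rfl⟩
      simp [hφc]
  have hrank : Module.finrank F (C.map φ) = k - 1 := by
    have h := LinearMap.finrank_range_add_finrank_ker (φ.domRestrict C)
    rw [hker, finrank_span_singleton (by simpa [Subtype.ext_iff] using hc0),
      LinearMap.range_domRestrict, hdim] at h
    omega
  have heD : eD F (n - d) (k - 1) m ≤ wtCount (C.map φ) m := by
    apply Nat.sInf_le
    refine ⟨C.map φ, hrank, ?_, rfl⟩
    rintro _ ⟨x, hx, rfl⟩ hne
    exact hres x hx (fun h => hne (hspan x h))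
  refine le_trans (Nat.add_le_add_right (Nat.mul_le_mul_left t heD) _) ?_
  -- counting
  let A : Finset (Fin n → F) := univ.filter (fun x => x ∈ C ∧ hammingNorm x = d)
  let B : Finset (Fin (n - d) → F) := univ.filter (fun y => y ∈ C.map φ ∧ hammingNorm y = m)
  have hA : wtCount C d = A.card := by
    rw [wtCount, ← Set.ncard_coe_finset]; congr 1; ext; simp [A]
  have hB : wtCount (C.map φ) m = B.card := by
    rw [wtCount, ← Set.ncard_coe_finset]; congr 1; ext; simp [B]
  rw [hA, hB]
  have h0B : (0 : Fin (n - d) → F) ∉ B := by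
    simp only [B, mem_filter, hammingNorm_zero]; omega
  have hfib : ∀ y ∈ B, t ≤ (A.filter (fun x => φ x = y)).card := by
    intro y hy
    simp only [B, mem_filter, mem_univ, true_and] at hy
    obtain ⟨⟨x, hx, rfl⟩, hw⟩ := hy
    have hxc : x ∉ Submodule.span F {c} := by
      intro h
      rw [hspan x h, hammingNorm_zero] at hw; omega
    have hmm := many_min (fun a : F => hammingNorm (x - a • c)) d (q - t) (hge x hx hxc)
      (by rw [hsum, hw, ← hq]; omega)
    rw [← hq] at hmm
    have hle : (univ.filter (fun a : F => hammingNorm (x - a • c) = d)).card ≤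
        (A.filter (fun z => φ z = φ x)).card := by
      apply Finset.card_le_card_of_injOn (fun a => x - a • c)
      · intro a ha
        simp only [coe_filter, mem_univ, true_and, Set.mem_setOf_eq] at ha
        simp only [A, coe_filter, mem_filter, mem_univ, true_and, Set.mem_setOf_eq]
        exact ⟨⟨C.sub_mem hx (C.smul_mem _ hcC), ha⟩, by simp [hφc]⟩
      · intro a _ b _ h
        exact smul_left_injective F hc0 (sub_right_injective h)
    omega
  have hfib0 : q - 1 ≤ (A.filter (fun x => φ x = 0)).card := by
    have : (univ.erase (0 : F)).card = q - 1 := by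
      rw [card_erase_of_mem (mem_univ _), card_univ]
    rw [← this]
    apply Finset.card_le_card_of_injOn (fun a => a • c)
    · intro a ha
      have ha0 : a ≠ 0 := by simpa using ha
      simp only [A, coe_filter, mem_filter, mem_univ, true_and, Set.mem_setOf_eq]
      refine ⟨⟨C.smul_mem _ hcC, ?_⟩, by simp [hφc]⟩
      rw [← hcd]
      simp [hammingNorm, ha0]
    · intro a _ b _ h
      exact smul_left_injective F hc0 h
  have htot : ∑ y ∈ insert 0 B, (A.filter (fun x => φ x = y)).card ≤ A.card := by
    rw [Finset.card_eq_sum_card_fiberwise (f := φ) (s := A) (t := univ) (by intro _ _; simp)]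
    exact Finset.sum_le_sum_of_subset (subset_univ _)
  rw [sum_insert h0B] at htot
  have hsB : B.card * t ≤ ∑ y ∈ B, (A.filter (fun x => φ x = y)).card := by
    have := Finset.card_nsmul_le_sum B _ t hfib
    simpa using this
  rw [mul_comm]
  omega
end

section
/- Let C be an [n,k,d]_q linear code with k ≥ 3 and let c be a codeword of C of weight d. Set t = q if q divides d, and t = d mod q otherwise. Then A_d(C) ≥ t · A_{⌈d/q⌉}(Υ_c(C)) + (q−1), where A_{⌈d/q⌉}(Υ_c(C)) is the number of codewords of weight ⌈d/q⌉ in the residual code of C under c. -/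
/-- The residual code of `C` with respect to the codeword `c`: the projection of `C`
onto the coordinate positions outside the support of `c`. -/
noncomputable def residualCode {F : Type*} [Field F] [DecidableEq F] {n : ℕ}
    (c : Fin n → F) (C : Submodule F (Fin n → F)) :
    Submodule F ({i : Fin n // c i = 0} → F) :=
  Submodule.map (LinearMap.funLeft F F Subtype.val) C

lemma wt_split {F : Type*} [Field F] [DecidableEq F] {n : ℕ} (c x : Fin n → F) :
    hammingNorm x + (Finset.univ.filter fun i => c i ≠ 0 ∧ x i = 0).card
      = hammingNorm (LinearMap.funLeft F F (Subtype.val : {i : Fin n // c i = 0} → Fin n) x)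
        + hammingNorm c := by
  have h1 : hammingNorm (LinearMap.funLeft F F (Subtype.val : {i : Fin n // c i = 0} → Fin n) x)
      = (Finset.univ.filter fun i => c i = 0 ∧ x i ≠ 0).card := by
    unfold hammingNorm
    rw [← Finset.card_map (Function.Embedding.subtype fun i : Fin n => c i = 0)]
    congr 1
    ext i
    rw [Finset.mem_map, Finset.mem_filter]
    constructor
    · rintro ⟨⟨j, hj⟩, hm, rfl⟩
      exact ⟨Finset.mem_univ _, hj, (Finset.mem_filter.mp hm).2⟩
    · rintro ⟨_, h, h'⟩
      exact ⟨⟨i, h⟩, Finset.mem_filter.mpr ⟨Finset.mem_univ _, h'⟩, rfl⟩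
  rw [h1]
  unfold hammingNorm
  simp only [Finset.card_filter, ← Finset.sum_add_distrib]
  apply Finset.sum_congr rfl
  intro i _
  by_cases h : c i = 0 <;> by_cases h' : x i = 0 <;> simp [h, h']

lemma sum_m {F : Type*} [Field F] [Fintype F] [DecidableEq F] {n : ℕ} (c v : Fin n → F) :
    ∑ a : F, (Finset.univ.filter fun i => c i ≠ 0 ∧ (v + a • c) i = 0).card = hammingNorm c := by
  unfold hammingNorm
  rw [Finset.card_eq_sum_card_fiberwise (f := fun i => - v i / c i) (t := Finset.univ)
    (fun _ _ => by simp)]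
  apply Finset.sum_congr rfl
  intro a _
  congr 1
  ext i
  simp only [Finset.mem_filter, Finset.mem_univ, true_and, Pi.add_apply, Pi.smul_apply, smul_eq_mul]
  refine and_congr_right fun h => ?_
  rw [div_eq_iff h]
  constructor
  · intro h; linear_combination -h
  · intro h; linear_combination -h

/-- for an `[n,k,d]_q` linear code `C` with `k ≥ 3` and a codeword `c`
of weight `d`, with `t = q` if `q ∣ d` and `t = d mod q` otherwise,
`A_d(C) ≥ t · A_{⌈d/q⌉}(Υ_c(C)) + (q-1)`. -/
theorem stmt_4 {F : Type*} [Field F] [Fintype F] [DecidableEq F]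
    (n k d : ℕ) (hk : 3 ≤ k)
    (C : Submodule F (Fin n → F))
    (hdim : Module.finrank F C = k)
    (hdist : minDistIs C d)
    (c : Fin n → F) (hc : c ∈ C) (hwc : hammingNorm c = d)
    (t : ℕ)
    (htdef : t = if Fintype.card F ∣ d then Fintype.card F else d % Fintype.card F) :
    t * wtCount (residualCode c C) ((d + Fintype.card F - 1) / Fintype.card F)
      + (Fintype.card F - 1) ≤ wtCount C d := by
  classical
  obtain ⟨⟨c', hc'C, hc'0, hc'd⟩, hmin⟩ := hdist
  have hdpos : 0 < d := by
    rw [← hc'd]; exact hammingNorm_pos_iff.mpr hc'0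
  have hcne : c ≠ 0 := by
    rw [← hammingNorm_pos_iff, hwc]; exact hdpos
  set q := Fintype.card F with hq
  have hq1 : 1 < q := Fintype.one_lt_card
  set w := (d + q - 1) / q with hw
  have hw1 : 1 ≤ w := by
    rw [hw, Nat.le_div_iff_mul_le (by omega)]; omega
  have ht : q * (w - 1) + t ≤ d := by
    have hdm := Nat.div_add_mod d q
    have hlt := Nat.mod_lt d (show 0 < q by omega)
    by_cases hdvd : q ∣ d
    · obtain ⟨e, he⟩ := hdvd
      have : w = e := by
        rw [hw, he, Nat.add_sub_assoc (by omega), Nat.mul_add_div (by omega),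
          Nat.div_eq_of_lt (by omega)]; rfl
      rw [htdef, if_pos ⟨e, he⟩, this, he]
      obtain ⟨f, rfl⟩ : ∃ f, e = f + 1 := ⟨e - 1, by omega⟩
      simp [Nat.mul_add]
    · have hmod : 0 < d % q := Nat.pos_of_ne_zero fun h => hdvd (Nat.dvd_of_mod_eq_zero h)
      have : w = d / q + 1 := by
        rw [hw]
        have e1 : d + q - 1 = q * (d / q + 1) + (d % q - 1) := by
          rw [Nat.mul_add]; omega
        have e2 : (d % q - 1) / q = 0 := Nat.div_eq_of_lt (by omega)
        rw [e1, Nat.mul_add_div (by omega), e2]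
      rw [htdef, if_neg hdvd, this]
      simp; omega
  set P := LinearMap.funLeft F F (Subtype.val : {i : Fin n // c i = 0} → Fin n) with hP
  have hPc : P c = 0 := by
    ext ⟨i, hi⟩; simpa [hP, LinearMap.funLeft_apply] using hi
  set S : Finset (Fin n → F) := Finset.univ.filter fun x => x ∈ C ∧ hammingNorm x = d with hS
  set R : Finset ({i : Fin n // c i = 0} → F) :=
    Finset.univ.filter fun x => x ∈ residualCode c C ∧ hammingNorm x = w with hR
  have e1 : wtCount C d = S.card := by
    unfold wtCount; rw [← Set.ncard_coe_finset]; simp [hS]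
  have e2 : wtCount (residualCode c C) w = R.card := by
    unfold wtCount; rw [← Set.ncard_coe_finset]; simp [hR]
  rw [e1, e2]
  have hsinj : Function.Injective fun a : F => a • c := smul_left_injective F hcne
  have h0 : q - 1 ≤ (S.filter fun x => P x = 0).card := by
    have : ((Finset.univ.erase (0 : F)).image fun a => a • c).card = q - 1 := by
      rw [Finset.card_image_of_injective _ hsinj, Finset.card_erase_of_mem (Finset.mem_univ _),
        Finset.card_univ]
    rw [← this]
    apply Finset.card_le_card
    intro x hx
    simp only [Finset.mem_image, Finset.mem_erase, Finset.mem_univ, and_true] at hx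
    obtain ⟨a, ha, rfl⟩ := hx
    simp only [hS, Finset.mem_filter, Finset.mem_univ, true_and]
    refine ⟨⟨C.smul_mem a hc, ?_⟩, by rw [map_smul, hPc, smul_zero]⟩
    rw [← hwc]
    exact hammingNorm_smul (fun _ => IsSMulRegular.of_ne_zero ha) c
  have h1 : ∀ r ∈ R, t ≤ (S.filter fun x => P x = r).card := by
    intro r hr
    simp only [hR, Finset.mem_filter, Finset.mem_univ, true_and] at hr
    obtain ⟨⟨v, hvC, hvr⟩, hrw⟩ := hr
    change P v = r at hvr
    have hr0 : r ≠ 0 := by rw [← hammingNorm_pos_iff, hrw]; omega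
    have hPx : ∀ a : F, P (v + a • c) = r := fun a => by
      rw [map_add, map_smul, hPc, smul_zero, add_zero, hvr]
    have hxC : ∀ a : F, v + a • c ∈ C := fun a => C.add_mem hvC (C.smul_mem a hc)
    have hx0 : ∀ a : F, v + a • c ≠ 0 := fun a h => hr0 (by rw [← hPx a, h, map_zero])
    have hsplit : ∀ a : F, hammingNorm (v + a • c) +
        (Finset.univ.filter fun i => c i ≠ 0 ∧ (v + a • c) i = 0).card = w + d := fun a => by
      have := wt_split c (v + a • c)
      rw [← hP, hPx a, hrw, hwc] at this
      exact this
    have hsum := sum_m c v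
    rw [hwc] at hsum
    set A : Finset F := Finset.univ.filter fun a => hammingNorm (v + a • c) = d with hA
    have hAt : t ≤ A.card := by
      have hle : ∑ a : F, (Finset.univ.filter fun i => c i ≠ 0 ∧ (v + a • c) i = 0).card
          ≤ ∑ a : F, ((w - 1) + if hammingNorm (v + a • c) = d then 1 else 0) := by
        apply Finset.sum_le_sum
        intro a _
        have h1 := hsplit a
        have h2 := hmin _ (hxC a) (hx0 a)
        split_ifs <;> omega
      rw [hsum, Finset.sum_add_distrib, ← Finset.card_filter, Finset.sum_const, Finset.card_univ,
        smul_eq_mul] at hle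
      change d ≤ q * (w - 1) + A.card at hle
      omega
    refine hAt.trans ?_
    rw [← Finset.card_image_of_injective A (f := fun a => v + a • c)
      (fun a b h => hsinj (add_left_cancel h))]
    apply Finset.card_le_card
    intro x hx
    simp only [Finset.mem_image, hA, Finset.mem_filter, Finset.mem_univ, true_and] at hx
    obtain ⟨a, ha, rfl⟩ := hx
    simp only [hS, Finset.mem_filter, Finset.mem_univ, true_and]
    exact ⟨⟨hxC a, ha⟩, hPx a⟩
  have h0R : (0 : {i : Fin n // c i = 0} → F) ∉ R := by
    simp only [hR, Finset.mem_filter, hammingNorm_zero]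
    omega
  have hfin : ∑ r ∈ insert 0 R, (S.filter fun x => P x = r).card ≤ S.card := by
    rw [Finset.card_eq_sum_card_fiberwise (s := S) (f := P) (t := Finset.univ)
      (fun _ _ => by simp)]
    exact Finset.sum_le_sum_of_subset (Finset.subset_univ _)
  rw [Finset.sum_insert h0R] at hfin
  have h2 := Finset.card_nsmul_le_sum R _ t h1
  rw [smul_eq_mul, mul_comm] at h2
  omega
end

section
/- Let C be an [n,k,d]_q Griesmer optimal linear code with k ≥ 3. Then: (1) if Γ_q(n,k,d) < k, then q divides d; (2) if q does not divide d, then n = g_q(k,d), i.e., C is a Griesmer code. -/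
/-- The Griesmer function `g_q(k,d) = ∑_{i=0}^{k-1} ⌈d/q^i⌉`. -/
def griesmerFn (q k d : ℕ) : ℕ := ∑ i ∈ Finset.range k, (d + q ^ i - 1) / q ^ i

/-- `Γ_q(n,k,d)`: equals `k` if `n = g_q(k,d)`, and otherwise the smallest positive
integer `k1` with `n - g_q(k1,d) ≥ g_q(k - k1, ⌈d/q^{k1}⌉ + 1)`. -/
noncomputable def GammaFn (q n k d : ℕ) : ℕ :=
  if n = griesmerFn q k d then k
  else sInf {k1 | 0 < k1 ∧
    griesmerFn q (k - k1) ((d + q ^ k1 - 1) / q ^ k1 + 1) ≤ n - griesmerFn q k1 d}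

theorem ceil_mul_aux (d a b : ℕ) (ha : 0 < a) (hb : 0 < b) :
    (d + a * b - 1) / (a * b) = ((d + a - 1) / a + b - 1) / b := by
  rw [← Nat.div_div_eq_div_mul]
  congr 1
  have h1 : (d + a * b - 1) = (d + a - 1) + a * (b - 1) := by
    obtain ⟨c, rfl⟩ : ∃ c, b = c + 1 := ⟨b - 1, by omega⟩
    simp only [Nat.add_sub_cancel]
    have : a * (c + 1) = a * c + a := by ring
    omega
  rw [h1, Nat.add_mul_div_left _ _ ha]
  generalize (d + a - 1) / a = x
  omega

theorem griesmerFn_succ_aux (q k d : ℕ) (hq : 0 < q) :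
    griesmerFn q (k + 1) d = d + griesmerFn q k ((d + q - 1) / q) := by
  unfold griesmerFn
  rw [Finset.sum_range_succ']
  simp only [pow_zero, Nat.div_one, Nat.add_sub_cancel]
  rw [add_comm]
  congr 1
  apply Finset.sum_congr rfl
  intro i _
  rw [pow_succ', ceil_mul_aux d q (q ^ i) hq (by positivity)]

theorem griesmerFn_mono_aux (q k : ℕ) {d e : ℕ} (h : d ≤ e) :
    griesmerFn q k d ≤ griesmerFn q k e := by
  unfold griesmerFn
  apply Finset.sum_le_sum
  intro i _
  apply Nat.div_le_div_right
  omega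

theorem griesmerFn_add_one_aux (q k d : ℕ) (hq : 0 < q) (h : ¬ q ∣ d) :
    griesmerFn q k (d + 1) ≤ griesmerFn q k d + 1 := by
  cases k with
  | zero => simp [griesmerFn]
  | succ k =>
    rw [griesmerFn_succ_aux _ _ _ hq, griesmerFn_succ_aux _ _ _ hq]
    have : (d + 1 + q - 1) / q = (d + q - 1) / q := by
      have h2 : d + 1 + q - 1 = (d + q - 1) + 1 := by omega
      rw [h2, Nat.succ_div, if_neg, add_zero]
      intro h3
      apply h
      have h4 : d + q - 1 + 1 = d + q := by omega
      rw [h4] at h3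
      simpa using h3
    rw [this]
    omega

theorem sum_wt_aux {F : Type*} [Field F] [Fintype F] [DecidableEq F] {ι : Type*} [Fintype ι]
    (c v : ι → F) :
    ∑ a : F, hammingNorm (v - a • c) + hammingNorm c ≤
      Fintype.card F * hammingNorm (fun i : {i // c i = 0} => v i) +
      Fintype.card F * hammingNorm c := by
  classical
  have e1 : ∀ u : ι → F, hammingNorm u = ∑ i, if u i ≠ 0 then 1 else 0 := by
    intro u
    simp [hammingNorm, Finset.card_filter]
  have e2 : hammingNorm (fun i : {i // c i = 0} => v i)
      = ∑ i, if c i = 0 ∧ v i ≠ 0 then 1 else 0 := by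
    rw [← Finset.card_filter]
    unfold hammingNorm
    refine Finset.card_bij (fun i _ => i.1) ?_ ?_ ?_
    · rintro ⟨i, hi⟩ h
      simpa [hi] using h
    · rintro ⟨i, hi⟩ _ ⟨j, hj⟩ _ h
      simpa using h
    · intro i hi
      simp only [Finset.mem_filter, Finset.mem_univ, true_and] at hi
      exact ⟨⟨i, hi.1⟩, by simpa using hi.2, rfl⟩
  rw [e2]
  simp only [e1]
  rw [Finset.sum_comm, ← Finset.sum_add_distrib, Finset.mul_sum, Finset.mul_sum,
    ← Finset.sum_add_distrib]
  apply Finset.sum_le_sum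
  intro i _
  by_cases hc : c i = 0
  · by_cases hv : v i = 0 <;> simp [hc, hv]
  · simp only [hc, Pi.sub_apply, Pi.smul_apply, smul_eq_mul, ne_eq, not_false_eq_true, if_true,
      false_and, if_false, mul_zero, zero_add, mul_one]
    rw [← Finset.card_filter]
    have : (Finset.univ.filter fun a : F => ¬ (v i - a * c i = 0)) ⊂ Finset.univ := by
      rw [Finset.filter_ssubset]
      refine ⟨v i / c i, Finset.mem_univ _, ?_⟩
      rw [div_mul_cancel₀ _ hc]
      simp
    have := Finset.card_lt_card this
    rw [Finset.card_univ] at this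
    omega

theorem griesmer_bound_aux {F : Type*} [Field F] [Fintype F] [DecidableEq F] (k : ℕ) :
    ∀ {ι : Type} [Fintype ι] (C : Submodule F (ι → F)) (d : ℕ), k ≤ Module.finrank F C →
      (∀ c ∈ C, c ≠ 0 → d ≤ hammingNorm c) →
      griesmerFn (Fintype.card F) k d ≤ Fintype.card ι := by
  classical
  induction k with
  | zero => intro ι _ C d _ _; simp [griesmerFn]
  | succ k ih =>
    intro ι _ C d hk hd
    have hq : 0 < Fintype.card F := Fintype.card_pos
    have hne : ∃ c ∈ C, c ≠ 0 := by
      apply Submodule.exists_mem_ne_zero_of_ne_bot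
      rintro rfl
      simp at hk
    have hex : ∃ w, ∃ c ∈ C, c ≠ 0 ∧ hammingNorm c = w := by
      obtain ⟨c, h1, h2⟩ := hne
      exact ⟨_, c, h1, h2, rfl⟩
    obtain ⟨c, hcC, hc0, hcw⟩ := Nat.find_spec hex
    have hmin : ∀ v ∈ C, v ≠ 0 → hammingNorm c ≤ hammingNorm v := by
      intro v hv hv0
      rw [hcw]
      exact Nat.find_min' hex ⟨v, hv, hv0, rfl⟩
    have hwpos : 0 < hammingNorm c := hammingNorm_pos_iff.2 hc0
    have key : ∀ v ∈ C, v ∉ Submodule.span F {c} → hammingNorm c ≤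
        Fintype.card F * hammingNorm (fun i : {i // c i = 0} => v i) := by
      intro v hv hvs
      have h1 := sum_wt_aux c v
      have h2 : Fintype.card F * hammingNorm c ≤ ∑ a : F, hammingNorm (v - a • c) := by
        rw [← smul_eq_mul, ← Finset.card_univ]
        apply Finset.card_nsmul_le_sum
        intro a _
        apply hmin _ (C.sub_mem hv (C.smul_mem a hcC))
        intro h
        apply hvs
        rw [sub_eq_zero.1 h]
        exact Submodule.smul_mem _ _ (Submodule.mem_span_singleton_self c)
      omega
    let f : C →ₗ[F] ({i // c i = 0} → F) :=
      (LinearMap.funLeft F F (Subtype.val : {i // c i = 0} → ι)).domRestrict C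
    have hf : ∀ v : C, f v = fun i : {i // c i = 0} => v.1 i := fun v => rfl
    have hker : LinearMap.ker f ≤ Submodule.span F {(⟨c, hcC⟩ : C)} := by
      intro v hv
      rw [LinearMap.mem_ker, hf] at hv
      by_contra hcon
      have := key v.1 v.2 (by
        intro h
        apply hcon
        rw [Submodule.mem_span_singleton] at h ⊢
        obtain ⟨a, ha⟩ := h
        exact ⟨a, Subtype.ext ha⟩)
      rw [hv] at this
      simp only [hammingNorm_zero] at this
      omega
    have hk1 : Module.finrank F (LinearMap.ker f) ≤ 1 :=
      (Submodule.finrank_mono hker).trans (by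
      simpa using finrank_span_le_card (R := F) ({(⟨c, hcC⟩ : C)} : Set C))
    have hrn := LinearMap.finrank_range_add_finrank_ker f
    have hres := ih (LinearMap.range f)
      ((hammingNorm c + Fintype.card F - 1) / Fintype.card F) (by omega) (by
        rintro _ ⟨v, rfl⟩ hv0
        have := key v.1 v.2 (by
          intro h
          apply hv0
          rw [Submodule.mem_span_singleton] at h
          obtain ⟨a, ha⟩ := h
          rw [hf, ← ha]
          ext i
          simp [i.2])
        rw [hf]
        rw [← Nat.lt_succ_iff, Nat.div_lt_iff_lt_mul hq, Nat.succ_mul, mul_comm]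
        omega)
    have hcard : hammingNorm c + Fintype.card {i // c i = 0} = Fintype.card ι := by
      rw [Fintype.card_subtype]
      unfold hammingNorm
      rw [add_comm, Finset.card_filter_add_card_filter_not, Finset.card_univ]
    calc griesmerFn (Fintype.card F) (k + 1) d
        ≤ griesmerFn (Fintype.card F) (k + 1) (hammingNorm c) :=
          griesmerFn_mono_aux _ _ (hd c hcC hc0)
      _ = _ := griesmerFn_succ_aux _ _ _ hq
      _ ≤ _ := by omega

/-- for an `[n,k,d]_q` Griesmer optimal linear code with `k ≥ 3`:
(1) if `Γ_q(n,k,d) < k` then `q ∣ d`; (2) if `q ∤ d` then `n = g_q(k,d)`. -/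
theorem stmt_5 {F : Type*} [Field F] [Fintype F] [DecidableEq F]
    (n k d : ℕ) (hk : 3 ≤ k)
    (C : Submodule F (Fin n → F))
    (hdim : Module.finrank F C = k)
    (hdist : minDistIs C d)
    (hopt : n < griesmerFn (Fintype.card F) k (d + 1)) :
    (GammaFn (Fintype.card F) n k d < k → Fintype.card F ∣ d) ∧
    (¬ Fintype.card F ∣ d → n = griesmerFn (Fintype.card F) k d) := by
  have h2 : ¬ Fintype.card F ∣ d → n = griesmerFn (Fintype.card F) k d := by
    intro h
    have h1 := griesmerFn_add_one_aux (Fintype.card F) k d Fintype.card_pos h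
    have h3 := griesmer_bound_aux k C d hdim.ge hdist.2
    rw [Fintype.card_fin] at h3
    omega
  refine ⟨fun hG => ?_, h2⟩
  by_contra h
  have := h2 h
  unfold GammaFn at hG
  rw [if_pos this] at hG
  exact lt_irrefl _ hG
end

section
/- Let C be an [n,k,d]_q Griesmer optimal linear code with q dividing d and Γ_q(n,k,d) ≥ 2. Let c be any codeword of C of weight d and let C′ be any (k−1)-dimensional linear subcode of C such that C is the direct sum of the span of c and C′. Then A_{d/q}(Υ_c(C)) ≤ min{ A_d(C′), min_{α ∈ 𝔽_q, α ≠ 0} |{ x ∈ C′ + αc : wt(x) = d }| }, where C′ + αc = { y + αc : y ∈ C′ }. -/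
lemma sum_hammingNorm {F : Type*} [Field F] [Fintype F] [DecidableEq F] {n : ℕ}
    (c y : Fin n → F) :
    ∑ a : F, hammingNorm (y + a • c) =
      Fintype.card F * hammingNorm (fun i : {i : Fin n // c i = 0} => y i.1)
        + (Fintype.card F - 1) * hammingNorm c := by
  have h1 : ∀ x : Fin n → F, hammingNorm x = ∑ i, if x i ≠ 0 then 1 else 0 := by
    intro x
    rw [hammingNorm, Finset.card_filter]
  have h2 : hammingNorm (fun i : {i : Fin n // c i = 0} => y i.1)
      = ∑ i, if c i = 0 then (if y i ≠ 0 then 1 else 0) else 0 := by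
    rw [hammingNorm, Finset.card_filter, ← Finset.sum_filter (fun i => c i = 0)]
    exact (Finset.sum_subtype (p := fun i => c i = 0) (Finset.univ.filter fun i => c i = 0) (by simp)
      (fun i => if y i ≠ 0 then 1 else 0)).symm
  rw [h2, h1 c, Finset.sum_congr rfl (fun a _ => h1 (y + a • c)), Finset.sum_comm,
    Finset.mul_sum, Finset.mul_sum, ← Finset.sum_add_distrib]
  refine Finset.sum_congr rfl fun i _ => ?_
  by_cases hi : c i = 0
  · simp [hi]
  · have h3 : (Finset.univ.filter fun a : F => (y + a • c) i ≠ 0)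
        = Finset.univ.erase (-(y i) / c i) := by
      ext a
      simp only [Finset.mem_filter, Finset.mem_univ, true_and, Finset.mem_erase, and_true,
        Pi.add_apply, Pi.smul_apply, smul_eq_mul, ne_eq, eq_div_iff hi, not_iff_not]
      rw [eq_neg_iff_add_eq_zero, add_comm]
    rw [← Finset.card_filter, h3, Finset.card_erase_of_mem (Finset.mem_univ _)]
    simp [hi]

lemma residual_le {F : Type*} [Field F] [Fintype F] [DecidableEq F]
    (n d : ℕ)
    (C : Submodule F (Fin n → F))
    (hdist : minDistIs C d)
    (hdvd : Fintype.card F ∣ d)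
    (c : Fin n → F) (hc : c ∈ C) (hwc : hammingNorm c = d)
    (C' : Submodule F (Fin n → F)) (hC'le : C' ≤ C)
    (hsum : Submodule.span F {c} ⊔ C' = C) (α : F) :
    wtCount (residualCode c C) (d / Fintype.card F) ≤
      Set.ncard {x : Fin n → F | (∃ y ∈ C', x = y + α • c) ∧ hammingNorm x = d} := by
  obtain ⟨⟨c0, _, hc0, hd0⟩, hmin⟩ := hdist
  have hd : 0 < d := by rw [← hd0]; exact hammingNorm_pos_iff.2 hc0
  obtain ⟨e, rfl⟩ := hdvd
  have hq : 0 < Fintype.card F := Fintype.card_pos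
  have he : 0 < e := Nat.pos_of_mul_pos_left hd
  rw [Nat.mul_div_cancel_left _ hq, wtCount]
  set S := {x : Fin n → F | (∃ y ∈ C', x = y + α • c) ∧
    hammingNorm x = Fintype.card F * e} with hS
  refine le_trans (Set.ncard_le_ncard (t := (fun x : Fin n → F =>
    fun i : {i : Fin n // c i = 0} => x i.1) '' S) ?_ (Set.toFinite _))
    (Set.ncard_image_le (Set.toFinite _))
  rintro u ⟨⟨x, hx, rfl⟩, hu⟩
  have hx' : x ∈ C := hx
  rw [← hsum, Submodule.mem_sup] at hx'
  obtain ⟨z, hz, y, hy, rfl⟩ := hx'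
  obtain ⟨b, rfl⟩ := Submodule.mem_span_singleton.1 hz
  have hproj : ∀ a : F, (fun i : {i : Fin n // c i = 0} => (y + a • c) i.1)
      = LinearMap.funLeft F F Subtype.val (b • c + y) := by
    intro a
    funext i
    simp [LinearMap.funLeft_apply, i.2]
  have hy0 := hproj 0
  simp only [zero_smul, add_zero] at hy0
  have hge : ∀ a ∈ (Finset.univ : Finset F),
      Fintype.card F * e ≤ hammingNorm (y + a • c) := by
    intro a _
    refine hmin _ (C.add_mem (hC'le hy) (C.smul_mem a hc)) fun h0 => ?_
    have := hproj a
    rw [h0] at this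
    rw [← this] at hu
    have h00 : hammingNorm (fun i : {i : Fin n // c i = 0} => (0 : Fin n → F) i.1) = 0 :=
      hammingNorm_eq_zero.2 rfl
    omega
  have hs := sum_hammingNorm c y
  rw [hy0, hu, hwc] at hs
  have hs2 : ∑ a : F, Fintype.card F * e = ∑ a : F, hammingNorm (y + a • c) := by
    rw [hs, Finset.sum_const, Finset.card_univ, smul_eq_mul]
    obtain ⟨m, hm⟩ := Nat.exists_eq_add_of_lt hq
    rw [hm]
    simp only [zero_add, Nat.add_sub_cancel]
    ring
  have hall := (Finset.sum_eq_sum_iff_of_le hge).1 hs2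
  exact ⟨y + α • c, ⟨⟨y, hy, rfl⟩, (hall α (Finset.mem_univ _)).symm⟩, hproj α⟩

/-- for an `[n,k,d]_q` Griesmer optimal code with `q ∣ d` and
`Γ_q(n,k,d) ≥ 2`, a weight-`d` codeword `c`, and a `(k-1)`-dimensional subcode `C'`
with `C = ⟨c⟩ ⊕ C'`, we have
`A_{d/q}(Υ_c(C)) ≤ min{A_d(C'), min_{α ≠ 0} |{x ∈ C' + αc : wt x = d}|}`. -/
theorem stmt_6 {F : Type*} [Field F] [Fintype F] [DecidableEq F]
    (n k d : ℕ)
    (C : Submodule F (Fin n → F))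
    (hdim : Module.finrank F C = k)
    (hdist : minDistIs C d)
    (hopt : n < griesmerFn (Fintype.card F) k (d + 1))
    (hdvd : Fintype.card F ∣ d)
    (hGamma : 2 ≤ GammaFn (Fintype.card F) n k d)
    (c : Fin n → F) (hc : c ∈ C) (hwc : hammingNorm c = d)
    (C' : Submodule F (Fin n → F)) (hC'le : C' ≤ C)
    (hC'dim : Module.finrank F C' = k - 1)
    (hsum : Submodule.span F {c} ⊔ C' = C)
    (hcap : c ∉ C') :
    wtCount (residualCode c C) (d / Fintype.card F) ≤ wtCount C' d ∧
    ∀ α : F, α ≠ 0 →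
      wtCount (residualCode c C) (d / Fintype.card F) ≤
        Set.ncard {x : Fin n → F | (∃ y ∈ C', x = y + α • c) ∧ hammingNorm x = d} := by
  have key := residual_le n d C hdist hdvd c hc hwc C' hC'le hsum
  refine ⟨?_, fun α _ => key α⟩
  have h := key 0
  have heq : {x : Fin n → F | (∃ y ∈ C', x = y + (0 : F) • c) ∧ hammingNorm x = d}
      = {x : Fin n → F | x ∈ C' ∧ hammingNorm x = d} := by
    ext x
    simp
  rw [heq] at h
  exact h
end

section
/- Let C be an [n,k,d]_q Griesmer optimal linear code and let k1 = min{Γ_q(n,k,d), k−1}. Then there exists a chain of linear subcodes C_1 ⊂ C_2 ⊂ ⋯ ⊂ C_{k1} ⊂ C such that for each 1 ≤ i ≤ k1, the subcode C_i has dimension i and effective length n(C_i) = g_q(i,d). -/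
/-- The effective length `n(C)` of a code: the size of the union of the supports of
its codewords. -/
noncomputable def effLen {F : Type*} [Field F] {ι : Type*} [Fintype ι]
    (C : Submodule F (ι → F)) : ℕ :=
  Set.ncard {i : ι | ∃ c ∈ C, c i ≠ 0}

open Finset in
/-- Weight of a vector on a set of coordinates. -/
def wtOn {F : Type*} [Field F] [DecidableEq F] {ι : Type*} (S : Finset ι) (c : ι → F) : ℕ :=
  (S.filter (fun i => c i ≠ 0)).card

lemma cdiv_le (a b c : ℕ) (hb : 0 < b) : (a + b - 1) / b ≤ c ↔ a ≤ b * c := by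
  rw [Nat.div_le_iff_le_mul_add_pred hb]
  constructor <;> intro h <;> omega

lemma cdiv_cdiv (d a b : ℕ) (ha : 0 < a) (hb : 0 < b) :
    ((d + a - 1) / a + b - 1) / b = (d + a * b - 1) / (a * b) := by
  apply eq_of_forall_ge_iff
  intro c
  rw [cdiv_le _ _ _ hb, cdiv_le _ _ _ ha, cdiv_le _ _ _ (Nat.mul_pos ha hb), mul_assoc]

lemma griesmer_add (q i j d : ℕ) (hq : 0 < q) :
    griesmerFn q (i + j) d = griesmerFn q i d + griesmerFn q j ((d + q ^ i - 1) / q ^ i) := by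
  unfold griesmerFn
  rw [Finset.sum_range_add]
  congr 1
  apply Finset.sum_congr rfl
  intro x _
  rw [cdiv_cdiv _ _ _ (pow_pos hq _) (pow_pos hq _), pow_add]

lemma griesmer_one (q d : ℕ) : griesmerFn q 1 d = d := by
  simp [griesmerFn]

lemma griesmer_mono (q m : ℕ) {d e : ℕ} (h : d ≤ e) : griesmerFn q m d ≤ griesmerFn q m e := by
  unfold griesmerFn
  apply Finset.sum_le_sum
  intro i _
  apply Nat.div_le_div_right
  omega

lemma griesmer_strict (q m d : ℕ) (hq : 0 < q) (hm : 0 < m) :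
    griesmerFn q m d < griesmerFn q m (d + 1) := by
  obtain ⟨m, rfl⟩ : ∃ t, m = 1 + t := ⟨m - 1, by omega⟩
  rw [griesmer_add _ _ _ _ hq, griesmer_add _ _ _ _ hq, griesmer_one, griesmer_one]
  have : griesmerFn q m ((d + q ^ 1 - 1) / q ^ 1) ≤ griesmerFn q m ((d + 1 + q ^ 1 - 1) / q ^ 1) :=
    griesmer_mono q m (Nat.div_le_div_right (by omega))
  omega

lemma wtOn_split {F : Type*} [Field F] [DecidableEq F] {ι : Type*} (S : Finset ι)
    (c x : ι → F) : wtOn S x = wtOn (S.filter (fun i => c i ≠ 0)) x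
      + wtOn (S.filter (fun i => ¬ c i ≠ 0)) x := by
  unfold wtOn
  rw [Finset.filter_comm, Finset.filter_comm (p := fun i => ¬ c i ≠ 0)]
  exact (Finset.card_filter_add_card_filter_not _).symm

lemma sum_wt_in {F : Type*} [Field F] [Fintype F] [DecidableEq F] {ι : Type*} (S : Finset ι)
    (c x : ι → F) : ∑ l : F, wtOn (S.filter (fun i => c i ≠ 0)) (x - l • c)
      = (Fintype.card F - 1) * wtOn S c := by
  unfold wtOn
  simp_rw [Finset.card_filter (fun i => (_ : ι → F) i ≠ 0)]
  rw [Finset.sum_comm, Finset.sum_filter, Finset.mul_sum]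
  apply Finset.sum_congr rfl
  intro i _
  split_ifs with h
  · rw [← Finset.card_filter, mul_one]
    have : (Finset.univ.filter fun l : F => (x - l • c) i ≠ 0) = Finset.univ.erase (x i / c i) := by
      ext l
      simp only [Finset.mem_filter, Finset.mem_univ, true_and, Finset.mem_erase, and_true,
        Pi.sub_apply, Pi.smul_apply, smul_eq_mul, ne_eq, sub_eq_zero]
      rw [eq_div_iff h]
      exact not_congr eq_comm
    rw [this, Finset.card_erase_of_mem (Finset.mem_univ _), Finset.card_univ]
  · simp

lemma wt_out {F : Type*} [Field F] [DecidableEq F] {ι : Type*} (S : Finset ι)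
    (c x : ι → F) (l : F) : wtOn (S.filter (fun i => ¬ c i ≠ 0)) (x - l • c)
      = wtOn (S.filter (fun i => ¬ c i ≠ 0)) x := by
  unfold wtOn
  congr 1
  apply Finset.filter_congr
  intro i hi
  have : c i = 0 := by simpa using (Finset.mem_filter.1 hi).2
  simp [this]

/-- The Griesmer bound. -/
lemma griesmer_bound {F : Type*} [Field F] [Fintype F] [DecidableEq F] {ι : Type*} [Fintype ι]
    (m : ℕ) : ∀ (d : ℕ) (S : Finset ι) (D : Submodule F (ι → F)), Module.finrank F D = m →
      (∀ c ∈ D, c ≠ 0 → d ≤ wtOn S c) → griesmerFn (Fintype.card F) m d ≤ S.card := by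
  have hq : 0 < Fintype.card F := Fintype.card_pos
  induction m with
  | zero => intro d S D _ _; simp [griesmerFn]
  | succ m ih =>
    intro d S D hD hd
    have hne : ∃ w, ∃ c ∈ D, c ≠ 0 ∧ wtOn S c = w := by
      have : D ≠ ⊥ := by
        rintro rfl
        simp at hD
      obtain ⟨c, hc, h0⟩ := Submodule.exists_mem_ne_zero_of_ne_bot this
      exact ⟨_, c, hc, h0, rfl⟩
    classical
    obtain ⟨c, hc, hc0, hcw⟩ := Nat.find_spec hne
    have hmin : ∀ x ∈ D, x ≠ 0 → wtOn S c ≤ wtOn S x := by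
      intro x hx hx0
      rw [hcw]
      exact Nat.find_min' hne ⟨x, hx, hx0, rfl⟩
    obtain ⟨E, hE1, hE2⟩ := exists_isCompl (⟨F ∙ c, (Submodule.span_singleton_le_iff_mem _ _).2 hc⟩ : Set.Iic D)
    rw [disjoint_iff] at hE1
    rw [codisjoint_iff] at hE2
    have h1 : (F ∙ c) ⊓ (E : Submodule F (ι → F)) = ⊥ := congrArg Subtype.val hE1
    have h2 : (F ∙ c) ⊔ (E : Submodule F (ι → F)) = D := congrArg Subtype.val hE2
    have hdimE : Module.finrank F (E : Submodule F (ι → F)) = m := by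
      have := Submodule.finrank_sup_add_finrank_inf_eq (F ∙ c) (E : Submodule F (ι → F))
      rw [h1, h2, hD, finrank_span_singleton hc0, finrank_bot] at this
      omega
    have key := ih ((wtOn S c + Fintype.card F - 1) / Fintype.card F)
      (S.filter (fun i => ¬ c i ≠ 0)) E hdimE (by
        intro x hx hx0
        rw [cdiv_le _ _ _ hq]
        have hs : ∀ l : F, wtOn S c ≤ wtOn S (x - l • c) := by
          intro l
          apply hmin _ (D.sub_mem (E.2 hx) (D.smul_mem _ hc))
          intro h
          apply hx0
          have : x ∈ (F ∙ c) ⊓ (E : Submodule F (ι → F)) :=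
            ⟨Submodule.mem_span_singleton.2 ⟨l, (sub_eq_zero.1 h).symm⟩, hx⟩
          rw [h1] at this
          simpa using this
        have hsum := Finset.sum_le_sum (s := (Finset.univ : Finset F)) (fun l _ => hs l)
        simp_rw [wtOn_split S c (x - _ • c)] at hsum
        rw [Finset.sum_add_distrib, sum_wt_in] at hsum
        simp_rw [wt_out] at hsum
        simp only [Finset.sum_const, Finset.card_univ, smul_eq_mul] at hsum
        obtain ⟨t, ht⟩ : ∃ t, Fintype.card F = t + 1 := ⟨Fintype.card F - 1, by omega⟩
        rw [ht] at hsum ⊢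
        simp only [Nat.add_sub_cancel] at hsum
        linarith)
    have hcard : wtOn S c + (S.filter (fun i => ¬ c i ≠ 0)).card = S.card :=
      Finset.card_filter_add_card_filter_not _
    calc griesmerFn (Fintype.card F) (m + 1) d ≤ griesmerFn (Fintype.card F) (m + 1) (wtOn S c) :=
          griesmer_mono _ _ (hd c hc hc0)
      _ = griesmerFn (Fintype.card F) (1 + m) (wtOn S c) := by rw [add_comm]
      _ ≤ S.card := by
          rw [griesmer_add _ _ _ _ hq, griesmer_one, pow_one]
          omega

open Classical in
/-- The support of a code as a finset. -/
noncomputable def suppFin {F : Type*} [Field F] {ι : Type*} [Fintype ι]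
    (C : Submodule F (ι → F)) : Finset ι := Finset.univ.filter (fun i => ∃ c ∈ C, c i ≠ 0)

lemma effLen_eq {F : Type*} [Field F] {ι : Type*} [Fintype ι]
    (C : Submodule F (ι → F)) : effLen C = (suppFin C).card := by
  unfold effLen suppFin
  rw [← Set.ncard_coe_finset]
  congr 1
  ext i
  simp

lemma griesmer_effLen {F : Type*} [Field F] [Fintype F] [DecidableEq F] {ι : Type*} [Fintype ι]
    (m d : ℕ) (D : Submodule F (ι → F)) (hm : Module.finrank F D = m)
    (hd : ∀ c ∈ D, c ≠ 0 → d ≤ hammingNorm c) :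
    griesmerFn (Fintype.card F) m d ≤ effLen D := by
  rw [effLen_eq]
  apply griesmer_bound m d _ D hm
  intro c hc h0
  refine (hd c hc h0).trans (Finset.card_le_card ?_)
  intro i hi
  simp only [Finset.mem_filter, Finset.mem_univ, true_and] at hi
  simp only [suppFin, Finset.mem_filter, Finset.mem_univ, true_and]
  exact ⟨⟨c, hc, hi⟩, hi⟩

/-- Extending a subcode by one vector. -/
lemma extend_step {F : Type*} [Field F] [Fintype F] [DecidableEq F] {ι : Type*} [Fintype ι]
    (k d i : ℕ) (C D : Submodule F (ι → F)) (hDC : D ≤ C)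
    (hC : Module.finrank F C = k) (hd : ∀ c ∈ C, c ≠ 0 → d ≤ hammingNorm c)
    (hD : Module.finrank F D = i) (hlen : effLen D = griesmerFn (Fintype.card F) i d)
    (hlt : Fintype.card ι - griesmerFn (Fintype.card F) i d < griesmerFn (Fintype.card F) (k - i)
      ((d + (Fintype.card F) ^ i - 1) / (Fintype.card F) ^ i + 1)) :
    ∃ D' : Submodule F (ι → F), D < D' ∧ D' ≤ C ∧ Module.finrank F D' = i + 1 ∧
      effLen D' = griesmerFn (Fintype.card F) (i + 1) d := by
  classical
  have hq : 0 < Fintype.card F := Fintype.card_pos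
  obtain ⟨E, hE1, hE2⟩ := exists_isCompl (⟨D, hDC⟩ : Set.Iic C)
  rw [disjoint_iff] at hE1
  rw [codisjoint_iff] at hE2
  have h1 : D ⊓ (E : Submodule F (ι → F)) = ⊥ := congrArg Subtype.val hE1
  have h2 : D ⊔ (E : Submodule F (ι → F)) = C := congrArg Subtype.val hE2
  have hdimE : Module.finrank F (E : Submodule F (ι → F)) = k - i := by
    have := Submodule.finrank_sup_add_finrank_inf_eq D (E : Submodule F (ι → F))
    rw [h1, h2, hD, hC, finrank_bot] at this
    omega
  have hex : ∃ x ∈ (E : Submodule F (ι → F)), x ≠ 0 ∧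
      wtOn (suppFin D)ᶜ x ≤ (d + (Fintype.card F) ^ i - 1) / (Fintype.card F) ^ i := by
    by_contra! hcon
    have := griesmer_bound (k - i) _ (suppFin D)ᶜ E hdimE (fun c hc h0 => hcon c hc h0)
    rw [Finset.card_compl, ← effLen_eq, hlen] at this
    exact absurd hlt (not_lt.2 this)
  obtain ⟨x, hxE, hx0, hxw⟩ := hex
  have hxD : x ∉ D := by
    intro h
    have : x ∈ D ⊓ (E : Submodule F (ι → F)) := ⟨h, hxE⟩
    rw [h1] at this
    exact hx0 (by simpa using this)
  have hD'C : D ⊔ (F ∙ x) ≤ C :=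
    sup_le hDC ((Submodule.span_singleton_le_iff_mem _ _).2 (E.2 hxE))
  have hdim' : Module.finrank F (D ⊔ (F ∙ x) : Submodule F (ι → F)) = i + 1 := by
    have := Submodule.finrank_sup_add_finrank_inf_eq D (F ∙ x)
    have hb : D ⊓ (F ∙ x) = ⊥ := by
      rw [eq_bot_iff, ← h1]
      exact inf_le_inf_left _ ((Submodule.span_singleton_le_iff_mem _ _).2 hxE)
    rw [hb, hD, finrank_span_singleton hx0, finrank_bot] at this
    omega
  refine ⟨D ⊔ (F ∙ x), ?_, hD'C, hdim', le_antisymm ?_ ?_⟩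
  · refine lt_of_le_of_ne le_sup_left ?_
    intro h
    apply hxD
    rw [h]
    exact Submodule.mem_sup_right (Submodule.mem_span_singleton_self x)
  · rw [griesmer_add _ _ _ _ hq, griesmer_one, ← hlen, effLen_eq, effLen_eq]
    refine le_trans ?_ (Nat.add_le_add_left hxw _)
    refine le_trans (Finset.card_le_card ?_) (Finset.card_union_le _ _)
    intro j hj
    simp only [suppFin, Finset.mem_filter, Finset.mem_univ, true_and] at hj
    obtain ⟨c, hc, hcj⟩ := hj
    by_cases hjD : j ∈ suppFin D
    · exact Finset.mem_union_left _ hjD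
    · apply Finset.mem_union_right
      simp only [Finset.mem_filter, Finset.mem_compl]
      refine ⟨hjD, fun hxj => ?_⟩
      obtain ⟨y, hy, z, hz, rfl⟩ := Submodule.mem_sup.1 hc
      obtain ⟨l, rfl⟩ := Submodule.mem_span_singleton.1 hz
      apply hjD
      simp only [suppFin, Finset.mem_filter, Finset.mem_univ, true_and]
      refine ⟨y, hy, ?_⟩
      simpa [hxj] using hcj
  · exact griesmer_effLen _ _ _ hdim' (fun c hc h0 => hd c (hD'C hc) h0)

/-- an `[n,k,d]_q` Griesmer optimal linear code `C` has a strictly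
increasing chain of subcodes `C_1 ⊂ ⋯ ⊂ C_{k1} ⊂ C` (where
`k1 = min{Γ_q(n,k,d), k-1}`) with `dim C_i = i` and `n(C_i) = g_q(i,d)`. -/
theorem stmt_8 {F : Type*} [Field F] [Fintype F] [DecidableEq F]
    (n k d : ℕ)
    (C : Submodule F (Fin n → F))
    (hdim : Module.finrank F C = k)
    (hdist : minDistIs C d)
    (hopt : n < griesmerFn (Fintype.card F) k (d + 1))
    (k1 : ℕ) (hk1 : k1 = min (GammaFn (Fintype.card F) n k d) (k - 1)) :
    ∃ D : Fin k1 → Submodule F (Fin n → F),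
      (∀ i, D i < C) ∧
      (∀ i j, i < j → D i < D j) ∧
      (∀ i : Fin k1, Module.finrank F (D i) = (i : ℕ) + 1 ∧
        effLen (D i) = griesmerFn (Fintype.card F) ((i : ℕ) + 1) d) := by
  have hq : 0 < Fintype.card F := Fintype.card_pos
  obtain ⟨⟨c, hcC, hc0, hcw⟩, hd⟩ := hdist
  let Good : ℕ → Submodule F (Fin n → F) → Prop := fun i D => D ≤ C ∧
    Module.finrank F D = i + 1 ∧ effLen D = griesmerFn (Fintype.card F) (i + 1) d
  have step : ∀ (i : ℕ) (D : Submodule F (Fin n → F)), ∃ D' : Submodule F (Fin n → F),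
      i + 1 < k1 → Good i D → D < D' ∧ Good (i + 1) D' := by
    intro i D
    by_cases h : i + 1 < k1 ∧ Good i D
    · obtain ⟨hi, hDC, hD, hlen⟩ := h
      have hiG : i + 1 < GammaFn (Fintype.card F) n k d := by omega
      have hik : i + 1 < k := by omega
      obtain ⟨D', h1, h2, h3, h4⟩ := extend_step k d (i + 1) C D hDC hdim hd hD hlen (by
        rw [Fintype.card_fin]
        unfold GammaFn at hiG
        split_ifs at hiG with hn
        · have := griesmer_add (Fintype.card F) (i + 1) (k - (i + 1)) d hq
          rw [Nat.add_sub_cancel' hik.le] at this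
          have h2 := griesmer_strict (Fintype.card F) (k - (i + 1))
            ((d + Fintype.card F ^ (i + 1) - 1) / Fintype.card F ^ (i + 1)) hq (by omega)
          omega
        · have := Nat.notMem_of_lt_sInf hiG
          simp only [Set.mem_ofPred_eq, not_and, not_le] at this
          exact this (Nat.succ_pos _))
      exact ⟨D', fun _ _ => ⟨h1, h2, h3, h4⟩⟩
    · exact ⟨D, fun h1 h2 => absurd ⟨h1, h2⟩ h⟩
  choose next hnext using step
  let f : ℕ → Submodule F (Fin n → F) := fun i => Nat.rec (F ∙ c) (fun i D => next i D) i
  have hf0 : Good 0 (f 0) := by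
    refine ⟨(Submodule.span_singleton_le_iff_mem _ _).2 hcC, finrank_span_singleton hc0, ?_⟩
    rw [zero_add, griesmer_one, ← hcw, effLen_eq]
    unfold hammingNorm suppFin
    congr 1
    ext j
    simp only [Finset.mem_filter, Finset.mem_univ, true_and]
    constructor
    · rintro ⟨y, hy, hyj⟩ h0
      obtain ⟨l, rfl⟩ := Submodule.mem_span_singleton.1 hy
      exact hyj (by simp [h0])
    · intro h
      exact ⟨c, Submodule.mem_span_singleton_self c, h⟩
  have hfg : ∀ i, i < k1 → Good i (f i) := by
    intro i
    induction i with
    | zero => intro _; exact hf0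
    | succ i ih => intro hi; exact (hnext i (f i) hi (ih (by omega))).2
  have hlt : ∀ i j, i < j → j < k1 → f i < f j := by
    intro i j hij
    induction j, hij using Nat.le_induction with
    | base => intro h; exact (hnext i (f i) h (hfg i (by omega))).1
    | succ j hj ih =>
      intro h
      exact (ih (by omega)).trans (hnext j (f j) h (hfg j (by omega))).1
  refine ⟨fun i => f i, ?_, fun i j hij => hlt i j hij j.2, fun i => (hfg i i.2).2⟩
  intro i
  obtain ⟨h1, h2, _⟩ := hfg i i.2
  refine lt_of_le_of_ne h1 ?_
  intro h
  change f i = C at h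
  rw [h, hdim] at h2
  have := i.2
  omega
end

section
/- Let k ≥ 4 and s ≥ 1 be integers. Every binary linear code with parameters [s(2^k − 1) − 10, k, s·2^{k−1} − 6]_2 has at least 5·2^{k−3} codewords of minimum weight s·2^{k−1} − 6, and there exists a binary linear code with these parameters having exactly 5·2^{k−3} minimum-weight codewords. -/
def ghi (a : ZMod 2) : ℤ := if a = 0 then 1 else -1

lemma ghi_add (a b : ZMod 2) : ghi (a + b) = ghi a * ghi b := by
  revert a b; decide

lemma zmod2_add_one_ne (a : ZMod 2) : (a + 1 ≠ 0) ↔ ¬ (a ≠ 0) := by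
  revert a; decide

lemma zmod2_ne_zero (a : ZMod 2) : a ≠ 0 ↔ a = 1 := by
  revert a; decide

/-- number of indices in `T` whose functional does not vanish on `v`. -/
def fwt {V κ : Type*} [AddCommGroup V] [Module (ZMod 2) V]
    (φ : κ → Module.Dual (ZMod 2) V) (T : Finset κ) (v : V) : ℕ :=
  (T.filter (fun i => φ i v ≠ 0)).card

section moments
variable {V κ : Type*} [AddCommGroup V] [Module (ZMod 2) V]
  (φ : κ → Module.Dual (ZMod 2) V)

lemma sum_ghi_zero [Fintype V] (p : Module.Dual (ZMod 2) V) (hp : p ≠ 0) :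
    ∑ v, ghi (p v) = 0 := by
  obtain ⟨u, hu⟩ : ∃ u, p u ≠ 0 := by
    by_contra! h
    exact hp (LinearMap.ext h)
  have h1 : ∑ v, ghi (p (v + u)) = ∑ v, ghi (p v) :=
    Fintype.sum_equiv (Equiv.addRight u) _ _ (fun v => rfl)
  have h2 : ∀ v, ghi (p (v + u)) = - ghi (p v) := by
    intro v
    rw [map_add, ghi_add, (zmod2_ne_zero _).1 hu]
    simp [ghi]
  simp only [h2, Finset.sum_neg_distrib] at h1
  linarith

lemma sum_ghi_nonneg [Fintype V] (p : Module.Dual (ZMod 2) V) :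
    0 ≤ ∑ v, ghi (p v) := by
  by_cases hp : p = 0
  · subst hp
    exact Finset.sum_nonneg (fun v _ => by simp [ghi])
  · rw [sum_ghi_zero p hp]

/-- the character sum over `T`. -/
def fX (T : Finset κ) (v : V) : ℤ := ∑ i ∈ T, ghi (φ i v)

lemma fX_eq (T : Finset κ) (v : V) : fX φ T v = T.card - 2 * fwt φ T v := by
  unfold fX fwt
  have h : ∀ i, ghi (φ i v) = 1 - 2 * (if φ i v ≠ 0 then 1 else 0) := by
    intro i
    unfold ghi
    by_cases h : φ i v = 0 <;> simp [h]
  simp only [h, Finset.sum_sub_distrib, ← Finset.mul_sum, Finset.sum_boole]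
  simp

lemma sum_fX [Fintype V] (hφ : ∀ i, φ i ≠ 0) (T : Finset κ) : ∑ v, fX φ T v = 0 := by
  unfold fX
  rw [Finset.sum_comm]
  exact Finset.sum_eq_zero (fun i _ => sum_ghi_zero _ (hφ i))

lemma sum_fX_sq [Fintype V] (T : Finset κ) :
    (T.card : ℤ) * Fintype.card V ≤ ∑ v, (fX φ T v) ^ 2 := by
  classical
  have h1 : ∑ v, (fX φ T v) ^ 2 = ∑ i ∈ T, ∑ j ∈ T, ∑ v, ghi ((φ i + φ j) v) := by
    calc ∑ v, (fX φ T v) ^ 2 = ∑ v, ∑ i ∈ T, ∑ j ∈ T, ghi ((φ i + φ j) v) := by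
          refine Finset.sum_congr rfl (fun v _ => ?_)
          rw [fX, sq, Finset.sum_mul_sum]
          simp only [LinearMap.add_apply, ghi_add]
      _ = _ := by
          rw [Finset.sum_comm]
          refine Finset.sum_congr rfl (fun v _ => ?_)
          rw [Finset.sum_comm]
  rw [h1]
  have h2 : ∀ i ∈ T, (Fintype.card V : ℤ) ≤ ∑ j ∈ T, ∑ v, ghi ((φ i + φ j) v) := by
    intro i hi
    have h3 : ∑ v, ghi ((φ i + φ i) v) = (Fintype.card V : ℤ) := by
      have : ∀ a : ZMod 2, a + a = 0 := by decide
      simp [LinearMap.add_apply, this, ghi]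
    rw [← h3]
    exact Finset.single_le_sum (f := fun j => ∑ v, ghi ((φ i + φ j) v))
      (fun j _ => sum_ghi_nonneg _) hi
  have := Finset.sum_le_sum h2
  simpa using this

/-- With `N = #T` and all character sums at least `-1`, they are all `-1` or `N`. -/
lemma extremal [Fintype V] (hφ : ∀ i, φ i ≠ 0) (T : Finset κ) (h : ∀ v, -1 ≤ fX φ T v) :
    (∀ v, fX φ T v = -1 ∨ fX φ T v = T.card) ∧
    (T.card + 1) * (Finset.univ.filter (fun v => fX φ T v = T.card)).card = Fintype.card V := by
  have hle : ∀ v, fX φ T v ≤ T.card := by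
    intro v; rw [fX_eq]; have : (0:ℤ) ≤ fwt φ T v := by positivity
    linarith
  have hterm : ∀ v, 0 ≤ (fX φ T v + 1) * (T.card - fX φ T v) := fun v =>
    mul_nonneg (by linarith [h v]) (by linarith [hle v])
  have hsum : ∑ v, (fX φ T v + 1) * (T.card - fX φ T v) ≤ 0 := by
    have e : ∀ v, (fX φ T v + 1) * (T.card - fX φ T v)
        = ((T.card : ℤ) - 1) * fX φ T v + T.card - (fX φ T v) ^ 2 := by intro v; ring
    simp only [e, Finset.sum_sub_distrib, Finset.sum_add_distrib, ← Finset.mul_sum,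
      sum_fX φ hφ T]
    have := sum_fX_sq φ T
    simp
    linarith
  have hz : ∀ v, (fX φ T v + 1) * (T.card - fX φ T v) = 0 := by
    have := (Finset.sum_eq_zero_iff_of_nonneg (s := Finset.univ)
      (f := fun v => (fX φ T v + 1) * (T.card - fX φ T v)) (fun v _ => hterm v)).1
      (le_antisymm hsum (Finset.sum_nonneg (fun v _ => hterm v)))
    exact fun v => this v (Finset.mem_univ v)
  have hor : ∀ v, fX φ T v = -1 ∨ fX φ T v = T.card := by
    intro v
    rcases mul_eq_zero.1 (hz v) with h | h
    · left; linarith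
    · right; linarith
  refine ⟨hor, ?_⟩
  have e : ∀ v, fX φ T v = ((T.card : ℤ) + 1) * (if fX φ T v = T.card then 1 else 0) - 1 := by
    intro v
    by_cases hv : fX φ T v = T.card
    · rw [if_pos hv, hv]; ring
    · rw [if_neg hv]; rcases hor v with h | h
      · rw [h]; ring
      · exact absurd h hv
  have hs := sum_fX φ hφ T
  rw [Finset.sum_congr rfl (fun v _ => e v), Finset.sum_sub_distrib, ← Finset.mul_sum,
    Finset.sum_boole] at hs
  simp at hs
  zify
  linarith

lemma fwt_add (T : Finset κ) (v u : V) (hT : ∀ i ∈ T, φ i u = 0) :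
    fwt φ T (v + u) = fwt φ T v := by
  unfold fwt
  congr 1
  refine Finset.filter_congr (fun i hi => ?_)
  rw [map_add, hT i hi, add_zero]

lemma fwt_add' (T : Finset κ) (v u : V) (hT : ∀ i ∈ T, φ i u ≠ 0) :
    fwt φ T v + fwt φ T (v + u) = T.card := by
  unfold fwt
  rw [← Finset.card_filter_add_card_filter_not (s := T) (fun i => φ i v ≠ 0)]
  congr 2
  refine Finset.filter_congr (fun i hi => ?_)
  rw [map_add, (zmod2_ne_zero _).1 (hT i hi), zmod2_add_one_ne]

lemma fwt_split (T : Finset κ) (v u : V) :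
    fwt φ (T.filter (fun i => φ i u ≠ 0)) v + fwt φ (T.filter (fun i => ¬ (φ i u ≠ 0))) v
      = fwt φ T v := by
  unfold fwt
  rw [Finset.filter_comm (fun i => φ i u ≠ 0) (fun i => φ i v ≠ 0),
    Finset.filter_comm (fun i => ¬ (φ i u ≠ 0)) (fun i => φ i v ≠ 0),
    Finset.card_filter_add_card_filter_not]

lemma fwt_res (T : Finset κ) (v u : V) :
    2 * fwt φ (T.filter (fun i => ¬ (φ i u ≠ 0))) v + fwt φ T u
      = fwt φ T v + fwt φ T (v + u) := by
  have h1 := fwt_split φ T v u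
  have h2 := fwt_split φ T (v + u) u
  have h3 := fwt_add φ (T.filter (fun i => ¬ (φ i u ≠ 0))) v u (by simp)
  have h4 := fwt_add' φ (T.filter (fun i => φ i u ≠ 0)) v u (by simp)
  have h5 : fwt φ T u = (T.filter (fun i => φ i u ≠ 0)).card := rfl
  omega

lemma even_wt [Fintype V] [Fintype κ] (hφ : ∀ i, φ i ≠ 0) (hκ : Fintype.card κ = 10) (k : ℕ)
    (hV : Fintype.card V = 2 ^ k) (hw : ∀ v, fwt φ Finset.univ v ≤ 6) (u : V) :
    Even (fwt φ Finset.univ u) := by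
  by_contra hodd
  rw [Nat.not_even_iff_odd] at hodd
  set w := fwt φ Finset.univ u with hwdef
  set T := (Finset.univ : Finset κ).filter (fun i => ¬ (φ i u ≠ 0)) with hTdef
  set S := (Finset.univ : Finset κ).filter (fun i => φ i u ≠ 0) with hSdef
  have hScard : S.card = w := rfl
  have hTcard : T.card + w = 10 := by
    have := Finset.card_filter_add_card_filter_not (s := (Finset.univ : Finset κ))
      (fun i => φ i u ≠ 0)
    rw [Finset.card_univ, hκ] at this
    change S.card + T.card = 10 at this
    omega
  have hw6 := hw u
  rw [← hwdef] at hw6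
  have hres : ∀ v, 2 * fwt φ T v + w ≤ 12 := by
    intro v
    have h0 := fwt_res φ Finset.univ v u
    change 2 * fwt φ T v + w = _ at h0
    have := hw v
    have := hw (v + u)
    omega
  have hge : ∀ v, -1 ≤ fX φ T v := by
    intro v
    rw [fX_eq]
    have := hres v
    obtain ⟨t, ht⟩ := hodd
    omega
  obtain ⟨hor, hcount⟩ := extremal φ hφ T hge
  rw [hV] at hcount
  have hdvd : (T.card + 1) ∣ 2 ^ k := ⟨_, hcount.symm⟩
  have hN : T.card = 9 ∨ T.card = 7 ∨ T.card = 5 := by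
    obtain ⟨t, ht⟩ := hodd
    omega
  rcases hN with hN | hN | hN
  · have h5 : 5 ∣ 2 ^ k := Dvd.dvd.trans (by rw [hN]; norm_num) hdvd
    have := (Nat.Prime.dvd_of_dvd_pow (by norm_num) h5)
    omega
  · have hS3 : S.card = 3 := by omega
    have hsq := sum_fX_sq φ S
    have hb : ∀ v, (fX φ S v) ^ 2 ≤ 1 + 8 * (if fX φ T v = T.card then 1 else 0) := by
      intro v
      have hST := fwt_split φ Finset.univ v u
      have hST' := fwt_split φ Finset.univ (v + u) u
      change fwt φ S v + fwt φ T v = _ at hST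
      change fwt φ S (v + u) + fwt φ T (v + u) = _ at hST'
      have h3 := fwt_add φ T v u (by simp [hTdef])
      have h4 := fwt_add' φ S v u (by simp [hSdef])
      have hv := hw v
      have hvu := hw (v + u)
      rcases hor v with h | h
      · rw [if_neg (by rw [h]; omega)]
        rw [fX_eq] at h
        have h5 : fX φ S v = 1 ∨ fX φ S v = -1 := by
          rw [fX_eq]; omega
        rcases h5 with h5 | h5 <;> rw [h5] <;> norm_num
      · rw [if_pos h]
        have h5 : -3 ≤ fX φ S v ∧ fX φ S v ≤ 3 := by
          rw [fX_eq]; omega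
        nlinarith [h5.1, h5.2]
    have hsum := Finset.sum_le_sum (s := (Finset.univ : Finset V)) (fun v _ => hb v)
    rw [Finset.sum_add_distrib, ← Finset.mul_sum, Finset.sum_boole] at hsum
    simp only [Finset.sum_const, Finset.card_univ, nsmul_eq_mul, mul_one] at hsum
    rw [hS3, hV] at hsq
    rw [hV] at hsum
    have hpos : 0 < 2 ^ k := by positivity
    rw [hN] at hcount hsum
    zify at hcount hpos
    push_cast at *
    linarith
  · have h5 : 3 ∣ 2 ^ k := Dvd.dvd.trans (by rw [hN]; norm_num) hdvd
    have := (Nat.Prime.dvd_of_dvd_pow (by norm_num) h5)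
    omega

lemma key_bound [Fintype V] [Fintype κ] (hφ : ∀ i, φ i ≠ 0) (hκ : Fintype.card κ = 10) (k : ℕ)
    (hV : Fintype.card V = 2 ^ k) (hw : ∀ v, fwt φ Finset.univ v ≤ 6) :
    5 * 2 ^ k ≤ 8 * (Finset.univ.filter (fun v : V => fwt φ Finset.univ v = 6)).card := by
  have hb : ∀ v, (fX φ Finset.univ v) ^ 2 - 12 * fX φ Finset.univ v + 20 ≤
      48 * (if fwt φ Finset.univ v = 6 then 1 else 0) := by
    intro v
    have he := even_wt φ hφ hκ k hV hw v
    have h6 := hw v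
    have hx := fX_eq φ Finset.univ v
    rw [Finset.card_univ, hκ] at hx
    rw [hx]
    generalize fwt φ Finset.univ v = w at *
    interval_cases w <;> first | (exfalso; revert he; decide) | norm_num
  have hsum := Finset.sum_le_sum (s := (Finset.univ : Finset V)) (fun v _ => hb v)
  rw [← Finset.mul_sum, Finset.sum_boole, Finset.sum_add_distrib, Finset.sum_sub_distrib,
    ← Finset.mul_sum, sum_fX φ hφ] at hsum
  have hsq := sum_fX_sq φ (Finset.univ : Finset κ)
  rw [Finset.card_univ, hκ, hV] at hsq
  simp only [Finset.sum_const, Finset.card_univ, nsmul_eq_mul, hV] at hsum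
  have : (5 * 2 ^ k : ℤ) ≤
      8 * ((Finset.univ.filter (fun v : V => fwt φ Finset.univ v = 6)).card : ℤ) := by
    push_cast at *
    linarith
  exact_mod_cast this

end moments

/-- The Griesmer function. -/
def grie : ℕ → ℕ → ℕ
  | 0, _ => 0
  | j + 1, d => d + grie j ((d + 1) / 2)

lemma grie_mono (j : ℕ) : ∀ {d e : ℕ}, d ≤ e → grie j d ≤ grie j e := by
  induction j with
  | zero => intro d e _; simp [grie]
  | succ j ih =>
    intro d e h
    have := ih (show (d + 1) / 2 ≤ (e + 1) / 2 by omega)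
    simp only [grie]; omega

lemma grie_pow (s j : ℕ) : grie j (s * 2 ^ j) + 2 * s = s * 2 ^ (j + 1) := by
  induction j with
  | zero => simp [grie]; ring
  | succ j ih =>
    have e : (s * 2 ^ (j + 1) + 1) / 2 = s * 2 ^ j := by
      rw [show s * 2 ^ (j + 1) = 2 * (s * 2 ^ j) by ring]; omega
    rw [grie, e]
    have : s * 2 ^ (j + 1 + 1) = s * 2 ^ (j + 1) + s * 2 ^ (j + 1) := by ring
    omega

lemma grie_a (s j : ℕ) (hs : 1 ≤ s) :
    grie (j + 3) (s * 2 ^ (j + 3) - 6) + 2 * s + 10 = s * 2 ^ (j + 4) := by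
  have h1 : 1 ≤ s * 2 ^ j := Nat.mul_pos hs (by positivity)
  have h := grie_pow s j
  have e3 : s * 2 ^ (j + 3) = 8 * (s * 2 ^ j) := by ring
  have e4 : s * 2 ^ (j + 4) = 16 * (s * 2 ^ j) := by ring
  have e1 : s * 2 ^ (j + 1) = 2 * (s * 2 ^ j) := by ring
  rw [e1] at h
  rw [e3, e4, grie, grie, grie]
  have a : (((8 * (s * 2 ^ j) - 6 + 1) / 2 + 1) / 2 + 1) / 2 = s * 2 ^ j := by omega
  rw [a]
  omega

lemma grie_b (s j : ℕ) (hs : 1 ≤ s) :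
    grie (j + 4) (s * 2 ^ (j + 3) - 6) + s + 10 = s * 2 ^ (j + 4) := by
  have key : ∀ (i d : ℕ), d ≤ s * 2 ^ i → s * 2 ^ i < d + 2 ^ i →
      grie (i + 1) d = grie i d + s := by
    intro i
    induction i with
    | zero => intro d h1 h2; simp [grie] at *; omega
    | succ i ih =>
      intro d h1 h2
      have e : s * 2 ^ (i + 1) = 2 * (s * 2 ^ i) := by ring
      have e' : 2 ^ (i + 1) = 2 * 2 ^ i := by ring
      rw [grie, ih ((d + 1) / 2) (by omega) (by omega), grie]
      omega
  have h8 : 1 ≤ 2 ^ j := Nat.one_le_two_pow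
  have e3 : 2 ^ (j + 3) = 8 * 2 ^ j := by ring
  have h9 : grie (j + 4) _ = _ := key (j + 3) (s * 2 ^ (j + 3) - 6) (by omega) (by omega)
  have := grie_a s j hs
  omega

section griesmer
variable {V κ : Type*} [AddCommGroup V] [Module (ZMod 2) V] [FiniteDimensional (ZMod 2) V]
  (φ : κ → Module.Dual (ZMod 2) V)

lemma ker_dual_finrank (f : Module.Dual (ZMod 2) V) :
    Module.finrank (ZMod 2) V ≤ Module.finrank (ZMod 2) (LinearMap.ker f) + 1 := by
  have h := LinearMap.finrank_range_add_finrank_ker f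
  have h2 := Submodule.finrank_le (LinearMap.range f)
  rw [Module.finrank_self] at h2
  omega

lemma griesmer (j : ℕ) : ∀ (W : Submodule (ZMod 2) V) (d : ℕ) (T : Finset κ),
    j ≤ Module.finrank (ZMod 2) W → (∀ v ∈ W, v ≠ 0 → d ≤ fwt φ T v) → grie j d ≤ T.card := by
  induction j with
  | zero => intro W d T _ _; simp [grie]
  | succ j ih =>
    intro W d T hW hd
    have hex : ∃ m, ∃ v ∈ W, v ≠ 0 ∧ fwt φ T v = m := by
      have hne : W ≠ ⊥ := by
        rintro rfl
        simp at hW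
      obtain ⟨v, hv, hv0⟩ := Submodule.exists_mem_ne_zero_of_ne_bot hne
      exact ⟨_, v, hv, hv0, rfl⟩
    classical
    obtain ⟨u, huW, hu0, hu⟩ := Nat.find_spec hex
    set d0 := Nat.find hex with hd0
    have hmin : ∀ v ∈ W, v ≠ 0 → d0 ≤ fwt φ T v := fun v hv hv0 =>
      Nat.find_min' hex ⟨v, hv, hv0, rfl⟩
    obtain ⟨f, hf⟩ : ∃ f : Module.Dual (ZMod 2) V, f u ≠ 0 := by
      by_contra! h
      exact hu0 ((Module.forall_dual_apply_eq_zero_iff (ZMod 2) u).1 h)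
    have h1 := ker_dual_finrank f
    have h2 := Submodule.finrank_sup_add_finrank_inf_eq W (LinearMap.ker f)
    have h3 := Submodule.finrank_le (W ⊔ LinearMap.ker f)
    have h4 := ih (W ⊓ LinearMap.ker f) ((d0 + 1) / 2) (T.filter (fun i => ¬ (φ i u ≠ 0)))
      (by omega) (by
        intro v hv hv0
        obtain ⟨hvW, hvf⟩ := Submodule.mem_inf.1 hv
        have hvu : v + u ≠ 0 := by
          intro h
          have : f (v + u) = 0 := by rw [h, map_zero]
          rw [map_add, LinearMap.mem_ker.1 hvf, zero_add] at this
          exact hf this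
        have a1 := hmin v hvW hv0
        have a2 := hmin (v + u) (W.add_mem hvW huW) hvu
        have a3 := fwt_res φ T v u
        omega)
    have h5 : fwt φ T u + (T.filter (fun i => ¬ (φ i u ≠ 0))).card = T.card :=
      Finset.card_filter_add_card_filter_not _
    have h6 := hd u huW hu0
    have h7 := grie_mono j (show (d + 1) / 2 ≤ (d0 + 1) / 2 by omega)
    rw [grie]
    omega

end griesmer

section transfer
variable {V : Type*} [AddCommGroup V] [Module (ZMod 2) V] [FiniteDimensional (ZMod 2) V]

lemma card_dual [Fintype (Module.Dual (ZMod 2) V)] :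
    Fintype.card (Module.Dual (ZMod 2) V) = 2 ^ Module.finrank (ZMod 2) V := by
  rw [Module.card_eq_pow_finrank (K := ZMod 2), Subspace.dual_finrank_eq, ZMod.card]

lemma card_nonzero [Fintype (Module.Dual (ZMod 2) V)]
    [Fintype {p : Module.Dual (ZMod 2) V // p ≠ 0}] :
    Fintype.card {p : Module.Dual (ZMod 2) V // p ≠ 0} + 1 = 2 ^ Module.finrank (ZMod 2) V := by
  classical
  have h := Fintype.card_subtype_compl (fun p : Module.Dual (ZMod 2) V => p = 0)
  rw [Fintype.card_subtype_eq, card_dual] at h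
  have : 1 ≤ 2 ^ Module.finrank (ZMod 2) V := Nat.one_le_two_pow
  have e : Fintype.card {p : Module.Dual (ZMod 2) V // p ≠ 0}
    = Fintype.card {p : Module.Dual (ZMod 2) V // ¬ p = 0} := Fintype.card_congr (Equiv.refl _)
  omega

lemma half_dual [Fintype (Module.Dual (ZMod 2) V)]
    [Fintype {p : Module.Dual (ZMod 2) V // p ≠ 0}] (j : ℕ)
    (hj : Module.finrank (ZMod 2) V = j + 1) (v : V) (hv : v ≠ 0) :
    ∑ q : {p : Module.Dual (ZMod 2) V // p ≠ 0}, (if q.1 v ≠ 0 then 1 else 0) = 2 ^ j := by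
  classical
  have h1 := sum_ghi_zero (Module.Dual.eval (ZMod 2) V v) (by
    intro h
    apply hv
    rw [← Module.forall_dual_apply_eq_zero_iff (ZMod 2) v]
    intro f
    have := LinearMap.congr_fun h f
    simpa using this)
  have h : ∀ p : Module.Dual (ZMod 2) V, ghi (Module.Dual.eval (ZMod 2) V v p)
      = 1 - 2 * ((if p v ≠ 0 then 1 else 0 : ℕ) : ℤ) := by
    intro p
    rw [Module.Dual.eval_apply]
    unfold ghi
    by_cases h : p v = 0 <;> simp [h]
  simp only [h, Finset.sum_sub_distrib, ← Finset.mul_sum] at h1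
  rw [← Nat.cast_sum] at h1
  have h2 : ∑ p : Module.Dual (ZMod 2) V, (if p v ≠ 0 then 1 else 0)
      = ∑ q : {p : Module.Dual (ZMod 2) V // p ≠ 0}, (if q.1 v ≠ 0 then 1 else 0) := by
    rw [← Finset.sum_subtype (Finset.univ.filter (fun p : Module.Dual (ZMod 2) V => p ≠ 0))
      (by simp) (fun p => if p v ≠ 0 then 1 else 0), Finset.sum_filter]
    refine Finset.sum_congr rfl (fun p _ => ?_)
    by_cases hp : p = 0
    · subst hp; simp
    · simp [hp]
  rw [h2] at h1
  simp only [Finset.sum_const, Finset.card_univ, card_dual, hj, nsmul_eq_mul, mul_one] at h1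
  have h3 : 2 ^ (j + 1) = 2 * 2 ^ j := by ring
  rw [h3] at h1
  push_cast at h1
  zify
  push_cast
  linarith

lemma sigma_fwt [Fintype {p : Module.Dual (ZMod 2) V // p ≠ 0}]
    (m : {p : Module.Dual (ZMod 2) V // p ≠ 0} → ℕ) (v : V) :
    fwt (fun x : (q : {p : Module.Dual (ZMod 2) V // p ≠ 0}) × Fin (m q) => x.1.1)
      Finset.univ v = ∑ q : {p : Module.Dual (ZMod 2) V // p ≠ 0}, (if q.1 v ≠ 0 then m q else 0) := by
  unfold fwt
  rw [Finset.card_filter, Fintype.sum_sigma]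
  refine Finset.sum_congr rfl (fun q _ => ?_)
  by_cases h : q.1 v = 0 <;> simp [h]

lemma lower_bound [Fintype V] {ι : Type*} [Fintype ι] (φ : ι → Module.Dual (ZMod 2) V) (s j : ℕ)
    (hs : 1 ≤ s) (hV : Module.finrank (ZMod 2) V = j + 4)
    (hι : Fintype.card ι + s + 10 = s * 2 ^ (j + 4))
    (hd : ∀ v, v ≠ 0 → s * 2 ^ (j + 3) - 6 ≤ fwt φ Finset.univ v) :
    5 * 2 ^ (j + 1) ≤
      (Finset.univ.filter (fun v : V => fwt φ Finset.univ v = s * 2 ^ (j + 3) - 6)).card := by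
  classical
  have : Finite (Module.Dual (ZMod 2) V) := Module.finite_of_finite (ZMod 2)
  let : Fintype (Module.Dual (ZMod 2) V) := Fintype.ofFinite _
  have h8 : 8 ≤ s * 2 ^ (j + 3) := by
    have : 1 ≤ s * 2 ^ j := Nat.mul_pos hs (by positivity)
    have e3 : s * 2 ^ (j + 3) = 8 * (s * 2 ^ j) := by ring
    omega
  -- no zero coordinate
  have hφ : ∀ i, φ i ≠ 0 := by
    intro i hi
    have h := griesmer φ (j + 4) ⊤ (s * 2 ^ (j + 3) - 6) (Finset.univ.erase i)
      (by rw [finrank_top, hV]) (by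
        intro v _ hv
        refine (hd v hv).trans (le_of_eq ?_)
        unfold fwt
        congr 1
        ext l
        simp only [Finset.mem_filter, Finset.mem_univ, true_and, Finset.mem_erase, and_true]
        refine ⟨fun h => ⟨?_, h⟩, fun h => h.2⟩
        rintro rfl
        exact h (by rw [hi]; rfl))
    have h2 := grie_b s j hs
    rw [Finset.card_erase_of_mem (Finset.mem_univ _), Finset.card_univ] at h
    have : 0 < Fintype.card ι := Fintype.card_pos_iff.2 ⟨i⟩
    omega
  let m : {p : Module.Dual (ZMod 2) V // p ≠ 0} → ℕ :=
    fun q => (Finset.univ.filter (fun i => φ i = q.1)).card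
  have hm : ∀ q, m q ≤ s := by
    intro q
    have h := griesmer φ (j + 3) (LinearMap.ker q.1) (s * 2 ^ (j + 3) - 6)
      (Finset.univ.filter (fun i => ¬ φ i = q.1))
      (by have := ker_dual_finrank q.1; omega) (by
        intro v hvk hv
        refine (hd v hv).trans (le_of_eq ?_)
        unfold fwt
        congr 1
        ext l
        simp only [Finset.mem_filter, Finset.mem_univ, true_and]
        refine ⟨fun h => ⟨?_, h⟩, fun h => h.2⟩
        intro hl
        exact h (by rw [hl]; exact hvk))
    have h2 := grie_a s j hs
    have h3 := Finset.card_filter_add_card_filter_not (s := (Finset.univ : Finset ι))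
      (fun i => φ i = q.1)
    rw [Finset.card_univ] at h3
    change m q + _ = _ at h3
    omega
  have hsumm : ∀ g : Module.Dual (ZMod 2) V → ℕ, ∑ i, g (φ i) = ∑ q, m q * g q.1 := by
    intro g
    rw [← Finset.sum_fiberwise Finset.univ
      (fun i => (⟨φ i, hφ i⟩ : {p : Module.Dual (ZMod 2) V // p ≠ 0})) (fun i => g (φ i))]
    refine Finset.sum_congr rfl (fun q _ => ?_)
    have : ∀ i ∈ Finset.univ.filter
        (fun i => (⟨φ i, hφ i⟩ : {p : Module.Dual (ZMod 2) V // p ≠ 0}) = q),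
        g (φ i) = g q.1 := by
      intro i hi
      rw [← (Finset.mem_filter.1 hi).2]
    rw [Finset.sum_congr rfl this, Finset.sum_const, smul_eq_mul]
    congr 2
    ext i
    simp [Subtype.ext_iff]
  let ψ := fun x : (q : {p : Module.Dual (ZMod 2) V // p ≠ 0}) × Fin (s - m q) => x.1.1
  have hκ : Fintype.card ((q : {p : Module.Dual (ZMod 2) V // p ≠ 0}) × Fin (s - m q)) = 10 := by
    rw [Fintype.card_sigma]
    simp only [Fintype.card_fin]
    have h1 := hsumm (fun _ => 1)
    simp only [Finset.sum_const, Finset.card_univ, smul_eq_mul, mul_one] at h1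
    have h2 : ∑ q, (s - m q) + ∑ q, m q
        = Fintype.card {p : Module.Dual (ZMod 2) V // p ≠ 0} * s := by
      rw [← Finset.sum_add_distrib, Finset.sum_congr rfl (fun q _ => Nat.sub_add_cancel (hm q))]
      simp
    have h3 := card_nonzero (V := V)
    rw [hV] at h3
    rw [← h3] at hι
    have : s * (Fintype.card {p : Module.Dual (ZMod 2) V // p ≠ 0} + 1)
      = Fintype.card {p : Module.Dual (ZMod 2) V // p ≠ 0} * s + s := by ring
    omega
  have hwt : ∀ v, v ≠ 0 → fwt ψ Finset.univ v + fwt φ Finset.univ v = s * 2 ^ (j + 3) := by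
    intro v hv
    have h1 : fwt φ Finset.univ v = ∑ q, m q * (if q.1 v ≠ 0 then 1 else 0) := by
      rw [← hsumm (fun p => if p v ≠ 0 then 1 else 0), fwt, Finset.card_filter]
    rw [sigma_fwt, h1, ← Finset.sum_add_distrib, ← half_dual (j + 3) hV v hv, Finset.mul_sum]
    refine Finset.sum_congr rfl (fun q _ => ?_)
    have := hm q
    split_ifs <;> omega
  have hw0 : fwt ψ Finset.univ 0 = 0 := by simp [fwt]
  have hle : ∀ v, fwt ψ Finset.univ v ≤ 6 := by
    intro v
    by_cases hv : v = 0
    · rw [hv, hw0]; omega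
    · have := hwt v hv
      have := hd v hv
      omega
  have hcard : Fintype.card V = 2 ^ (j + 4) := by
    rw [Module.card_eq_pow_finrank (K := ZMod 2), hV, ZMod.card]
  have hfin := key_bound ψ (fun x => x.1.2) hκ (j + 4) hcard hle
  have hsub : (Finset.univ.filter (fun v : V => fwt ψ Finset.univ v = 6)).card ≤
      (Finset.univ.filter (fun v : V => fwt φ Finset.univ v = s * 2 ^ (j + 3) - 6)).card := by
    refine Finset.card_le_card (fun v hv => ?_)
    simp only [Finset.mem_filter, Finset.mem_univ, true_and] at hv ⊢
    have hv0 : v ≠ 0 := by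
      rintro rfl
      omega
    have := hwt v hv0
    omega
  have e : 2 ^ (j + 4) = 8 * 2 ^ (j + 1) := by ring
  omega

end transfer

section construction

/-- the ten vectors of weight two or three in `𝔽₂⁴`. -/
def G10 : Finset (Fin 4 → ZMod 2) :=
  Finset.univ.filter (fun a => hammingNorm a = 2 ∨ hammingNorm a = 3)

lemma G10_card : G10.card = 10 := by decide +kernel

lemma G10_zero : ∀ a ∈ G10, a ≠ 0 := by decide +kernel

/-- the weight function of the ten points. -/
def h10 (b : Fin 4 → ZMod 2) : ℕ := (G10.filter (fun a => ∑ i, a i * b i ≠ 0)).card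

lemma h10_le : ∀ b, h10 b ≤ 6 := by decide +kernel

lemma h10_zero : h10 0 = 0 := by decide +kernel

lemma h10_count : (Finset.univ.filter (fun b => h10 b = 6)).card = 10 := by decide +kernel

variable (j : ℕ)

/-- the message space. -/
abbrev MV (j : ℕ) : Type := (Fin 4 → ZMod 2) × (Fin j → ZMod 2)

/-- the functional attached to a vector of `𝔽₂⁴`. -/
noncomputable def L10 (a : Fin 4 → ZMod 2) : Module.Dual (ZMod 2) (MV j) :=
  ∑ i, a i • (LinearMap.proj i ∘ₗ LinearMap.fst (ZMod 2) (Fin 4 → ZMod 2) (Fin j → ZMod 2))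

lemma L10_apply (a : Fin 4 → ZMod 2) (v : MV j) : L10 j a v = ∑ i, a i * v.1 i := by
  simp [L10, LinearMap.sum_apply]

lemma L10_inj : Function.Injective (L10 j) := by
  intro a b h
  funext i
  have := LinearMap.congr_fun h (Pi.single i 1, 0)
  simpa [L10_apply, Pi.single_apply] using this

lemma MV_finrank : Module.finrank (ZMod 2) (MV j) = j + 4 := by
  rw [Module.finrank_prod]; simp; omega

lemma construction (s : ℕ) (hs : 1 ≤ s) (n : ℕ) (hn : n + s + 10 = s * 2 ^ (j + 4)) :
    ∃ φ : Fin n → Module.Dual (ZMod 2) (MV j),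
      ∀ v, v ≠ 0 → fwt φ Finset.univ v + h10 v.1 = s * 2 ^ (j + 3) := by
  classical
  have : Finite (Module.Dual (ZMod 2) (MV j)) := Module.finite_of_finite (ZMod 2)
  let : Fintype (Module.Dual (ZMod 2) (MV j)) := Fintype.ofFinite _
  let F : {p : Module.Dual (ZMod 2) (MV j) // p ≠ 0} → ℕ :=
    fun q => if q.1 ∈ G10.image (L10 j) then 1 else 0
  have hF : ∀ q, F q ≤ s := by
    intro q
    change (if q.1 ∈ G10.image (L10 j) then 1 else 0) ≤ s
    split_ifs <;> omega
  have hG0 : ∀ a ∈ G10, L10 j a ≠ 0 := by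
    intro a ha h
    apply G10_zero a ha
    apply L10_inj j
    rw [h]
    ext <;> simp [L10]
  have hFsum : ∀ (P : Module.Dual (ZMod 2) (MV j) → Prop) [DecidablePred P],
      ∑ q, (if P q.1 then F q else 0) = (G10.filter (fun a => P (L10 j a))).card := by
    intro P _
    have h1 : ∀ q : {p : Module.Dual (ZMod 2) (MV j) // p ≠ 0}, (if P q.1 then F q else 0)
        = if (P q.1 ∧ q.1 ∈ G10.image (L10 j)) then 1 else 0 := by
      intro q
      by_cases hP : P q.1 <;> simp [hP, F]
    rw [Finset.sum_congr rfl (fun q _ => h1 q), ← Finset.card_filter]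
    symm
    refine Finset.card_bij (fun a ha => ⟨L10 j a, hG0 a (Finset.mem_filter.1 ha).1⟩) ?_ ?_ ?_
    · intro a ha
      obtain ⟨h1, h2⟩ := Finset.mem_filter.1 ha
      simp only [Finset.mem_filter, Finset.mem_univ, true_and]
      exact ⟨h2, Finset.mem_image_of_mem _ h1⟩
    · intro a _ b _ h
      exact L10_inj j (Subtype.ext_iff.1 h)
    · rintro ⟨q, hq⟩ h
      obtain ⟨h1, h2⟩ := (Finset.mem_filter.1 h).2
      obtain ⟨a, ha, rfl⟩ := Finset.mem_image.1 h2
      exact ⟨a, Finset.mem_filter.2 ⟨ha, h1⟩, rfl⟩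
  have hcard : Fintype.card ((q : {p : Module.Dual (ZMod 2) (MV j) // p ≠ 0}) × Fin (s - F q))
      = n := by
    rw [Fintype.card_sigma]
    simp only [Fintype.card_fin]
    have h1 := hFsum (fun _ => True)
    simp only [if_true, Finset.filter_true, G10_card] at h1
    have h2 : ∑ q, (s - F q) + ∑ q, F q
        = Fintype.card {p : Module.Dual (ZMod 2) (MV j) // p ≠ 0} * s := by
      rw [← Finset.sum_add_distrib, Finset.sum_congr rfl (fun q _ => Nat.sub_add_cancel (hF q))]
      simp
    have h3 := card_nonzero (V := MV j)
    rw [MV_finrank] at h3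
    rw [← h3] at hn
    have : s * (Fintype.card {p : Module.Dual (ZMod 2) (MV j) // p ≠ 0} + 1)
      = Fintype.card {p : Module.Dual (ZMod 2) (MV j) // p ≠ 0} * s + s := by ring
    omega
  let e := (Fintype.equivFinOfCardEq hcard).symm
  refine ⟨fun i => (e i).1.1, fun v hv => ?_⟩
  have h1 : fwt (fun i => (e i).1.1) Finset.univ v = fwt
      (fun x : (q : {p : Module.Dual (ZMod 2) (MV j) // p ≠ 0}) × Fin (s - F q) => x.1.1)
      Finset.univ v := by
    unfold fwt
    rw [Finset.card_filter, Finset.card_filter]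
    exact Fintype.sum_equiv e _ _ (fun _ => rfl)
  have h2 : h10 v.1 = ∑ q : {p : Module.Dual (ZMod 2) (MV j) // p ≠ 0},
      (if q.1 v ≠ 0 then F q else 0) := by
    rw [hFsum (fun p => p v ≠ 0), h10]
    simp only [L10_apply]
  rw [h1, sigma_fwt, h2, ← Finset.sum_add_distrib, ← half_dual (j + 3) (MV_finrank j) v hv,
    Finset.mul_sum]
  refine Finset.sum_congr rfl (fun q _ => ?_)
  have := hF q
  split_ifs <;> omega

lemma count_MV : (Finset.univ.filter (fun v : MV j => h10 v.1 = 6)).card = 5 * 2 ^ (j + 1) := by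
  have h : (Finset.univ.filter (fun v : MV j => h10 v.1 = 6))
      = (Finset.univ.filter (fun b => h10 b = 6)) ×ˢ (Finset.univ : Finset (Fin j → ZMod 2)) := by
    ext v; simp
  rw [h, Finset.card_product, h10_count]
  simp [ZMod.card]
  ring

end construction

lemma wtCount_eq (n : ℕ) (C : Submodule (ZMod 2) (Fin n → ZMod 2)) [Fintype C] (d : ℕ) :
    wtCount C d = (Finset.univ.filter (fun v : C => hammingNorm v.1 = d)).card := by
  rw [wtCount, ← Set.ncard_coe_finset, ← Set.ncard_image_of_injective _ Subtype.val_injective]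
  congr 1
  ext c
  simp [and_comm]

lemma part_one (n j s : ℕ) (hs : 1 ≤ s) (hn : n + s + 10 = s * 2 ^ (j + 4))
    (C : Submodule (ZMod 2) (Fin n → ZMod 2)) (hC : Module.finrank (ZMod 2) C = j + 4)
    (hd : minDistIs C (s * 2 ^ (j + 3) - 6)) :
    5 * 2 ^ (j + 1) ≤ wtCount C (s * 2 ^ (j + 3) - 6) := by
  classical
  let _ : Fintype C := Fintype.ofFinite _
  rw [wtCount_eq]
  refine lower_bound (V := C) (fun i : Fin n => (LinearMap.proj i).comp C.subtype) s j hs hC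
    (by rw [Fintype.card_fin]; exact hn) ?_
  intro v hv
  exact hd.2 v.1 v.2 (fun h => hv (Subtype.ext h))

lemma part_two (n j s : ℕ) (hs : 1 ≤ s) (hn : n + s + 10 = s * 2 ^ (j + 4)) :
    ∃ C : Submodule (ZMod 2) (Fin n → ZMod 2),
      Module.finrank (ZMod 2) C = j + 4 ∧ minDistIs C (s * 2 ^ (j + 3) - 6) ∧
        wtCount C (s * 2 ^ (j + 3) - 6) = 5 * 2 ^ (j + 1) := by
  classical
  have h8 : 8 ≤ s * 2 ^ (j + 3) := by
    have : 1 ≤ s * 2 ^ j := Nat.mul_pos hs (by positivity)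
    have e3 : s * 2 ^ (j + 3) = 8 * (s * 2 ^ j) := by ring
    omega
  obtain ⟨φ, hφ⟩ := construction j s hs n hn
  let E : MV j →ₗ[ZMod 2] (Fin n → ZMod 2) := LinearMap.pi φ
  have hE : ∀ v, hammingNorm (E v) = fwt φ Finset.univ v := fun v => rfl
  have hinj : Function.Injective E := by
    rw [← LinearMap.ker_eq_bot, LinearMap.ker_eq_bot']
    intro v hv
    by_contra hv0
    have h1 := hφ v hv0
    have h2 := h10_le v.1
    rw [← hE, hv, hammingNorm_zero] at h1
    omega
  have hiff : ∀ v, hammingNorm (E v) = s * 2 ^ (j + 3) - 6 ↔ h10 v.1 = 6 := by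
    intro v
    by_cases hv : v = 0
    · subst hv
      rw [map_zero, hammingNorm_zero, Prod.fst_zero, h10_zero]
      omega
    · have h1 := hφ v hv
      have h2 := h10_le v.1
      rw [hE]
      omega
  have hcount : wtCount (LinearMap.range E) (s * 2 ^ (j + 3) - 6) = 5 * 2 ^ (j + 1) := by
    rw [← count_MV j, wtCount, ← Set.ncard_coe_finset, ← Set.ncard_image_of_injective _ hinj]
    congr 1
    ext c
    simp only [Set.mem_setOf_eq, LinearMap.mem_range, Set.mem_image, Finset.coe_filter,
      Finset.mem_univ, true_and]
    constructor
    · rintro ⟨⟨v, rfl⟩, hv⟩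
      exact ⟨v, (hiff v).1 hv, rfl⟩
    · rintro ⟨v, hv, rfl⟩
      exact ⟨⟨v, rfl⟩, (hiff v).2 hv⟩
  refine ⟨LinearMap.range E, ?_, ⟨?_, ?_⟩, hcount⟩
  · rw [LinearMap.finrank_range_of_inj hinj, MV_finrank]
  · have hne : (Finset.univ.filter (fun v : MV j => h10 v.1 = 6)).Nonempty := by
      rw [← Finset.card_pos, count_MV]; positivity
    obtain ⟨v, hv⟩ := hne
    have hv6 := (Finset.mem_filter.1 hv).2
    refine ⟨E v, ⟨v, rfl⟩, ?_, (hiff v).2 hv6⟩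
    intro h0
    have := (hiff v).2 hv6
    rw [h0, hammingNorm_zero] at this
    omega
  · rintro _ ⟨v, rfl⟩ hv
    have hv0 : v ≠ 0 := by
      rintro rfl
      exact hv (map_zero E)
    have h1 := hφ v hv0
    have h2 := h10_le v.1
    rw [hE]
    omega

/-- for `k ≥ 4` and `s ≥ 1`, every
`[s(2^k-1)-10, k, s·2^{k-1}-6]_2` binary linear code has at least `5·2^{k-3}`
minimum-weight codewords, and this bound is attained. -/
theorem stmt_16 (k s : ℕ) (hk : 4 ≤ k) (hs : 1 ≤ s) :
    (∀ C : Submodule (ZMod 2) (Fin (s * (2 ^ k - 1) - 10) → ZMod 2),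
      Module.finrank (ZMod 2) C = k → minDistIs C (s * 2 ^ (k - 1) - 6) →
        5 * 2 ^ (k - 3) ≤ wtCount C (s * 2 ^ (k - 1) - 6)) ∧
    (∃ C : Submodule (ZMod 2) (Fin (s * (2 ^ k - 1) - 10) → ZMod 2),
      Module.finrank (ZMod 2) C = k ∧ minDistIs C (s * 2 ^ (k - 1) - 6) ∧
        wtCount C (s * 2 ^ (k - 1) - 6) = 5 * 2 ^ (k - 3)) := by
  obtain ⟨j, rfl⟩ : ∃ j, k = j + 4 := ⟨k - 4, by omega⟩
  have e1 : j + 4 - 1 = j + 3 := by omega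
  have e3 : j + 4 - 3 = j + 1 := by omega
  have hn : s * (2 ^ (j + 4) - 1) - 10 + s + 10 = s * 2 ^ (j + 4) := by
    have h1 : 1 ≤ 2 ^ j := Nat.one_le_two_pow
    have h2 : 2 ^ (j + 4) = 16 * 2 ^ j := by ring
    have h3 : s * 2 ^ (j + 4) = s * (2 ^ (j + 4) - 1) + s := by
      rw [← Nat.mul_succ]
      congr 1
      omega
    have h4 : 1 * 15 ≤ s * (2 ^ (j + 4) - 1) := Nat.mul_le_mul hs (by omega)
    omega
  rw [e1, e3]
  exact ⟨fun C hC hd => part_one _ j s hs hn C hC hd, part_two _ j s hs hn⟩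
end

section
/- For every integer s ≥ 0: every [7s+4, 3, 4s+2]_2 binary linear code has at least 6 codewords of weight 4s+2, and there exists a [7s+4, 3, 4s+2]_2 binary linear code with exactly 6 codewords of weight 4s+2. -/
/-- Hamming weight as a sum of indicators. -/
lemma hn_sum {n : ℕ} (u : Fin n → ZMod 2) :
    hammingNorm u = ∑ i, (if u i ≠ 0 then 1 else 0) := by
  unfold hammingNorm
  rw [Finset.card_filter]

lemma hn_parity {n : ℕ} (u v : Fin n → ZMod 2) :
    ∃ k, hammingNorm u + hammingNorm v = hammingNorm (u + v) + 2 * k := by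
  refine ⟨∑ i, (if u i ≠ 0 ∧ v i ≠ 0 then 1 else 0), ?_⟩
  rw [hn_sum, hn_sum, hn_sum, Finset.mul_sum, ← Finset.sum_add_distrib,
    ← Finset.sum_add_distrib]
  refine Finset.sum_congr rfl fun i _ => ?_
  have : ∀ p q : ZMod 2, (if p ≠ 0 then 1 else 0) + (if q ≠ 0 then 1 else 0)
      = (if p + q ≠ 0 then 1 else 0) + 2 * (if p ≠ 0 ∧ q ≠ 0 then 1 else 0) := by decide
  exact this (u i) (v i)

lemma hn_seven {n : ℕ} (a b c : Fin n → ZMod 2) :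
    hammingNorm a + hammingNorm b + hammingNorm c + hammingNorm (a + b) + hammingNorm (a + c)
      + hammingNorm (b + c) + hammingNorm (a + b + c) ≤ 4 * n := by
  simp only [hn_sum, ← Finset.sum_add_distrib]
  have : 4 * n = ∑ i : Fin n, 4 := by simp [mul_comm]
  rw [this]
  refine Finset.sum_le_sum fun i _ => ?_
  have : ∀ p q r : ZMod 2, (if p ≠ 0 then 1 else 0) + (if q ≠ 0 then 1 else 0)
      + (if r ≠ 0 then 1 else 0) + (if p + q ≠ 0 then 1 else 0) + (if p + r ≠ 0 then 1 else 0)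
      + (if q + r ≠ 0 then 1 else 0) + (if p + q + r ≠ 0 then 1 else 0) ≤ 4 := by decide
  exact this (a i) (b i) (c i)

set_option maxHeartbeats 4000000 in
lemma lower_bound_s17 (s : ℕ) (C : Submodule (ZMod 2) (Fin (7 * s + 4) → ZMod 2))
    (h3 : Module.finrank (ZMod 2) C = 3) (hd : minDistIs C (4 * s + 2)) :
    6 ≤ wtCount C (4 * s + 2) := by
  have hmin := hd.2
  let B := Module.finBasisOfFinrankEq (ZMod 2) C h3
  obtain ⟨a, ha⟩ : ∃ a, a = B 0 := ⟨_, rfl⟩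
  obtain ⟨b, hb⟩ : ∃ b, b = B 1 := ⟨_, rfl⟩
  obtain ⟨c, hc⟩ : ∃ c, c = B 2 := ⟨_, rfl⟩
  have hind : ∀ p q r : ZMod 2, p • a + q • b + r • c = 0 → p = 0 ∧ q = 0 ∧ r = 0 := by
    intro p q r h
    have := Fintype.linearIndependent_iff.1 B.linearIndependent ![p, q, r]
      (by simpa [Fin.sum_univ_three, ha, hb, hc] using h)
    exact ⟨this 0, this 1, this 2⟩
  have hspan : ∀ x : C, ∃ p q r : ZMod 2, x = p • a + q • b + r • c := by
    intro x
    refine ⟨B.repr x 0, B.repr x 1, B.repr x 2, ?_⟩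
    conv_lhs => rw [← B.sum_repr x]
    rw [Fin.sum_univ_three, ha, hb, hc]
  have hspan' : ∀ x : C, x = 0 ∨ x = a ∨ x = b ∨ x = c ∨ x = a + b ∨ x = a + c ∨ x = b + c
      ∨ x = a + b + c := by
    intro x
    obtain ⟨p, q, r, rfl⟩ := hspan x
    have h01 : ∀ t : ZMod 2, t = 0 ∨ t = 1 := by decide
    rcases h01 p with rfl | rfl <;> rcases h01 q with rfl | rfl <;>
      rcases h01 r with rfl | rfl <;> simp
  have key : ∀ p q r : ZMod 2, ¬ (p = 0 ∧ q = 0 ∧ r = 0) →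
      4 * s + 2 ≤ hammingNorm ((p • a + q • b + r • c : C) : Fin (7 * s + 4) → ZMod 2) := by
    intro p q r h
    refine hmin _ (Subtype.property _) fun h0 => h (hind p q r (Subtype.ext h0))
  have w1 := key 1 0 0 (by decide)
  have w2 := key 0 1 0 (by decide)
  have w3 := key 0 0 1 (by decide)
  have w4 := key 1 1 0 (by decide)
  have w5 := key 1 0 1 (by decide)
  have w6 := key 0 1 1 (by decide)
  have w7 := key 1 1 1 (by decide)
  simp only [one_smul, zero_smul, add_zero, zero_add, Submodule.coe_add] at w1 w2 w3 w4 w5 w6 w7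
  have hs := hn_seven (a : Fin (7 * s + 4) → ZMod 2) b c
  obtain ⟨k1, e1⟩ := hn_parity (a : Fin (7 * s + 4) → ZMod 2) b
  obtain ⟨k2, e2⟩ := hn_parity (a : Fin (7 * s + 4) → ZMod 2) c
  obtain ⟨k3, e3⟩ := hn_parity (b : Fin (7 * s + 4) → ZMod 2) c
  obtain ⟨k4, e4⟩ := hn_parity (a + b : Fin (7 * s + 4) → ZMod 2) c
  have hx : ∃ x : C, ∀ y : C, y ≠ 0 → y ≠ x →
      hammingNorm (y : Fin (7 * s + 4) → ZMod 2) = 4 * s + 2 := by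
    by_contra hcon
    push Not at hcon
    obtain ⟨y, hy0, -, hy⟩ := hcon 0
    obtain ⟨z, hz0, hzy, hz⟩ := hcon y
    have hy' : 4 * s + 3 ≤ hammingNorm (y : Fin (7 * s + 4) → ZMod 2) :=
      lt_of_le_of_ne (hmin _ y.2 fun h => hy0 (Subtype.ext h)) (Ne.symm hy)
    have hz' : 4 * s + 3 ≤ hammingNorm (z : Fin (7 * s + 4) → ZMod 2) :=
      lt_of_le_of_ne (hmin _ z.2 fun h => hz0 (Subtype.ext h)) (Ne.symm hz)
    clear hy hz hcon key hind hspan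
    rcases hspan' y with rfl | rfl | rfl | rfl | rfl | rfl | rfl | rfl <;>
    rcases hspan' z with rfl | rfl | rfl | rfl | rfl | rfl | rfl | rfl <;>
    first
    | exact hy0 rfl
    | exact hz0 rfl
    | exact hzy rfl
    | (clear hspan' hy0 hz0 hzy; try simp only [Submodule.coe_add] at hy' hz'
       omega)
  obtain ⟨x, hx⟩ := hx
  have hcard : Nat.card C = 8 := by
    rw [Module.natCard_eq_pow_finrank (K := ZMod 2), h3]; simp
  unfold wtCount
  have hC : (C : Set (Fin (7 * s + 4) → ZMod 2)).ncard = 8 := hcard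
  have hsub : (C : Set (Fin (7 * s + 4) → ZMod 2)) \ {0, (x : Fin (7 * s + 4) → ZMod 2)} ⊆
      {c | c ∈ C ∧ hammingNorm c = 4 * s + 2} := by
    rintro y ⟨hyC, hy⟩
    simp only [Set.mem_insert_iff, Set.mem_singleton_iff, not_or] at hy
    exact ⟨hyC, hx ⟨y, hyC⟩ (fun h => hy.1 (congrArg Subtype.val h))
      (fun h => hy.2 (congrArg Subtype.val h))⟩
  have h1 := Set.ncard_le_ncard hsub (Set.toFinite _)
  have h2 := Set.le_ncard_diff {0, (x : Fin (7 * s + 4) → ZMod 2)}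
    (C : Set (Fin (7 * s + 4) → ZMod 2)) (Set.toFinite _)
  have h3 := Set.ncard_insert_le (0 : Fin (7 * s + 4) → ZMod 2) {(x : Fin (7 * s + 4) → ZMod 2)}
  rw [Set.ncard_singleton] at h3
  omega

/-- The columns of the generator matrix, repeated with period seven. -/
def colG : Fin 7 → Fin 3 → ZMod 2 :=
  ![![1,0,0], ![0,1,0], ![0,0,1], ![1,1,1], ![1,1,0], ![1,0,1], ![0,1,1]]

/-- Entry of the codeword of `x` at position `i`. -/
def entryG (x : Fin 3 → ZMod 2) (i : ℕ) : ZMod 2 :=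
  ∑ j, x j * colG (Fin.ofNat 7 i) j

/-- The encoding map. -/
def encG (n : ℕ) : (Fin 3 → ZMod 2) →ₗ[ZMod 2] (Fin n → ZMod 2) where
  toFun x i := entryG x i
  map_add' x y := by
    funext i
    simp [entryG, add_mul, Finset.sum_add_distrib]
  map_smul' r x := by
    funext i
    simp [entryG, Finset.mul_sum, mul_assoc]

lemma wt_encG (s : ℕ) (x : Fin 3 → ZMod 2) (hx : x ≠ 0) :
    hammingNorm (encG (7 * s + 4) x) = 4 * s + if x = 1 then 4 else 2 := by
  rw [hn_sum]
  change ∑ i : Fin (7 * s + 4), (if entryG x i ≠ 0 then 1 else 0) = _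
  rw [Fin.sum_univ_eq_sum_range (fun i => if entryG x i ≠ 0 then 1 else 0) (7 * s + 4)]
  induction s with
  | zero =>
    simp only [Nat.mul_zero, zero_add]
    revert x
    decide
  | succ s ih =>
    have e : 7 * (s + 1) + 4 = 7 * s + 4 + 7 := by ring
    rw [e, Finset.sum_range_add, ih]
    have : ∑ i ∈ Finset.range 7, (if entryG x (7 * s + 4 + i) ≠ 0 then 1 else 0) = 4 := by
      have hper : ∀ i, entryG x (7 * s + 4 + i) = entryG x (4 + i) := by
        intro i
        have : Fin.ofNat 7 (7 * s + 4 + i) = Fin.ofNat 7 (4 + i) := by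
          apply Fin.ext
          simp only [Fin.ofNat]
          omega
        simp only [entryG, this]
      simp only [hper]
      clear ih e hper
      revert x
      decide
    rw [this]
    ring

lemma encG_inj (s : ℕ) : Function.Injective (encG (7 * s + 4)) := by
  rw [injective_iff_map_eq_zero]
  intro x h
  by_contra hx
  have := wt_encG s x hx
  rw [h, hammingNorm_zero] at this
  split_ifs at this

/-- every `[7s+4, 3, 4s+2]_2` binary linear code has at least 6
minimum-weight codewords, and this bound is attained. -/
theorem stmt_17 (s : ℕ) :
    (∀ C : Submodule (ZMod 2) (Fin (7 * s + 4) → ZMod 2),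
      Module.finrank (ZMod 2) C = 3 → minDistIs C (4 * s + 2) →
        6 ≤ wtCount C (4 * s + 2)) ∧
    (∃ C : Submodule (ZMod 2) (Fin (7 * s + 4) → ZMod 2),
      Module.finrank (ZMod 2) C = 3 ∧ minDistIs C (4 * s + 2) ∧
        wtCount C (4 * s + 2) = 6) := by
  refine ⟨fun C => lower_bound_s17 s C, LinearMap.range (encG (7 * s + 4)), ?_, ⟨?_, ?_⟩, ?_⟩
  · rw [LinearMap.finrank_range_of_inj (encG_inj s)]
    simp
  · refine ⟨encG _ ![1, 0, 0], ⟨_, rfl⟩, ?_, ?_⟩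
    · intro h
      have h' := (injective_iff_map_eq_zero _).1 (encG_inj s) _ h
      exact absurd h' (by decide)
    · rw [wt_encG s _ (by decide), if_neg (by decide)]
  · rintro _ ⟨x, rfl⟩ h
    have hx : x ≠ 0 := by
      rintro rfl
      exact h (map_zero _)
    rw [wt_encG s x hx]
    split_ifs <;> omega
  · unfold wtCount
    have : {c | c ∈ LinearMap.range (encG (7 * s + 4)) ∧ hammingNorm c = 4 * s + 2}
        = encG (7 * s + 4) '' ((Finset.univ.filter fun x : Fin 3 → ZMod 2 => x ≠ 0 ∧ x ≠ 1 :
          Finset (Fin 3 → ZMod 2)) : Set (Fin 3 → ZMod 2)) := by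
      ext c
      constructor
      · rintro ⟨⟨x, rfl⟩, h⟩
        have hx : x ≠ 0 := by
          rintro rfl
          rw [map_zero, hammingNorm_zero] at h
          omega
        refine ⟨x, ?_, rfl⟩
        simp only [Finset.coe_filter, Finset.mem_univ, true_and, Set.mem_ofPred_eq]
        refine ⟨hx, fun h1 => ?_⟩
        rw [wt_encG s x hx, if_pos h1] at h
        omega
      · rintro ⟨x, hx, rfl⟩
        simp only [Finset.coe_filter, Finset.mem_univ, true_and, Set.mem_ofPred_eq] at hx
        exact ⟨⟨x, rfl⟩, by rw [wt_encG s x hx.1, if_neg hx.2]⟩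
    rw [this, Set.ncard_image_of_injective _ (encG_inj s), Set.ncard_coe_finset]
    decide
end

section
/- For every integer s ≥ 0: every [15s+12, 4, 8s+6]_2 binary linear code has at least 12 codewords of weight 8s+6, and there exists a [15s+12, 4, 8s+6]_2 binary linear code with exactly 12 codewords of weight 8s+6. -/
abbrev V4 := Fin 4 → ZMod 2

/-- Standard inner product on `𝔽_2^4`. -/
def ip (h q : V4) : ZMod 2 := h 0 * q 0 + h 1 * q 1 + h 2 * q 2 + h 3 * q 3

set_option maxRecDepth 100000 in
lemma ip_count1 : ∀ q : V4, (Finset.univ.filter fun h : V4 => ip h q ≠ 0).card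
    = if q = 0 then 0 else 8 := by decide +kernel

set_option maxRecDepth 100000 in
lemma ip_count1' : ∀ h : V4, (Finset.univ.filter fun q : V4 => ip h q ≠ 0).card
    = if h = 0 then 0 else 8 := by decide +kernel

set_option maxRecDepth 100000 in
lemma ip_count2 : ∀ q r : V4,
    4 ∣ (Finset.univ.filter fun h : V4 => ip h q ≠ 0 ∧ ip h r ≠ 0).card := by decide +kernel

set_option maxRecDepth 100000 in
lemma ip_count3 : ∀ a b c : V4, (a ≠ 0 ∧ b ≠ 0 ∧ a ≠ b ∧ c ≠ 0 ∧ c ≠ a ∧ c ≠ b ∧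
    c ≠ a + b) →
    (Finset.univ.filter fun q : V4 => ip a q = 0 ∧ ip b q = 0 ∧ ip c q = 0).card ≤ 2 := by
  decide +kernel

lemma supp_le (e : V4 → ℕ) (he0 : e 0 = 0) (hsum : ∑ h, e h = 6)
    (hdiv : ∀ q, 4 ∣ ∑ h with ip h q ≠ 0, e h) :
    (Finset.univ.filter fun h => e h ≠ 0).card ≤ 3 := by
  set E : V4 → ℕ := fun q => ∑ h with ip h q ≠ 0, e h with hE
  have hE6 : ∀ q, E q ≤ 6 := fun q => by
    rw [← hsum]; exact Finset.sum_le_sum_of_subset (Finset.filter_subset _ _)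
  have hE4 : ∀ q, E q = if E q ≠ 0 then 4 else 0 := fun q => by
    have h1 := hE6 q
    have h2 : 4 ∣ E q := hdiv q
    split_ifs <;> omega
  have hEs : ∑ q, E q = 48 := by
    simp only [hE, Finset.sum_filter]
    rw [Finset.sum_comm]
    have : ∀ h : V4, (∑ q, if ip h q ≠ 0 then e h else 0) = 8 * e h := fun h => by
      rw [← Finset.sum_filter, Finset.sum_const, ip_count1']
      split_ifs with h0
      · subst h0; simp [he0]
      · simp
    simp only [this]
    rw [← Finset.mul_sum, hsum]
    norm_num
  have hc : (Finset.univ.filter fun q => E q ≠ 0).card = 12 := by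
    rw [Finset.sum_congr rfl fun q _ => hE4 q, ← Finset.sum_filter, Finset.sum_const] at hEs
    simp only [smul_eq_mul] at hEs
    omega
  have hc0 : (Finset.univ.filter fun q => E q = 0).card = 4 := by
    have := Finset.card_filter_add_card_filter_not (s := (Finset.univ : Finset V4))
      (fun q => E q = 0)
    have h16 : (Finset.univ : Finset V4).card = 16 := by simp
    rw [h16] at this
    simp only [ne_eq] at hc
    omega
  by_contra hlt
  push Not at hlt
  set S := Finset.univ.filter fun h => e h ≠ 0 with hS
  have hmem : ∀ h, h ∈ S ↔ e h ≠ 0 := fun h => by simp [hS]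
  have hne0 : ∀ h ∈ S, h ≠ 0 := fun h hh h0 => by
    subst h0; exact (hmem _).1 hh he0
  obtain ⟨a, ha, b, hb, hab⟩ := Finset.one_lt_card.1 (show 1 < S.card by omega)
  obtain ⟨c, hcS, hcn⟩ := Finset.exists_mem_notMem_of_card_lt_card
    (s := ({a, b, a + b} : Finset V4)) (t := S) (lt_of_le_of_lt Finset.card_le_three hlt)
  simp only [Finset.mem_insert, Finset.mem_singleton, not_or] at hcn
  have h2 := ip_count3 a b c ⟨hne0 a ha, hne0 b hb, hab, hne0 c hcS, hcn.1, hcn.2.1, hcn.2.2⟩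
  have hperp : ∀ h ∈ S, ∀ q, E q = 0 → ip h q = 0 := fun h hh q hq => by
    by_contra hne
    simp only [hE, Finset.sum_eq_zero_iff, Finset.mem_filter, Finset.mem_univ, true_and] at hq
    exact (hmem h).1 hh (hq h hne)
  have h3 : (Finset.univ.filter fun q => E q = 0).card ≤
      (Finset.univ.filter fun q : V4 => ip a q = 0 ∧ ip b q = 0 ∧ ip c q = 0).card := by
    apply Finset.card_le_card
    intro q hq
    simp only [Finset.mem_filter, Finset.mem_univ, true_and] at hq ⊢
    exact ⟨hperp a ha q hq, hperp b hb q hq, hperp c hcS q hq⟩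
  omega

lemma core (s : ℕ) {ι : Type*} [Fintype ι] (hn : Fintype.card ι = 15 * s + 12) (p : ι → V4)
    (w : V4 → ℕ) (hw : ∀ h, w h = (Finset.univ.filter fun i => ip h (p i) ≠ 0).card)
    (hd : ∀ h, h ≠ 0 → 8 * s + 6 ≤ w h) :
    12 ≤ (Finset.univ.filter fun h => w h = 8 * s + 6).card := by
  have w0 : w 0 = 0 := by rw [hw]; simp [ip]
  set e : V4 → ℕ := fun h => if h = 0 then 0 else w h - (8 * s + 6) with he
  have hwe : ∀ h, w h = (if h ≠ 0 then 8 * s + 6 else 0) + e h := fun h => by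
    by_cases h0 : h = 0
    · subst h0; simp [he, w0]
    · have := hd h h0
      simp only [he, h0, if_false, ne_eq, not_false_eq_true, if_true]; omega
  have hcard15 : (Finset.univ.filter fun h : V4 => h ≠ 0).card = 15 := by decide
  have hsw : ∑ h, w h = 15 * (8 * s + 6) + ∑ h, e h := by
    rw [Finset.sum_congr rfl fun h _ => hwe h, Finset.sum_add_distrib, ← Finset.sum_filter,
      Finset.sum_const, hcard15, smul_eq_mul]
  have hsw2 : ∑ h, w h = 8 * (Finset.univ.filter fun i => p i ≠ 0).card := by
    simp only [hw, Finset.card_filter]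
    rw [Finset.sum_comm, Finset.mul_sum]
    refine Finset.sum_congr rfl fun i _ => ?_
    rw [← Finset.card_filter, ip_count1]
    by_cases h0 : p i = 0 <;> simp only [h0, ne_eq, not_true, not_false_eq_true, if_true, if_false, mul_one, mul_zero]
  have hle : (Finset.univ.filter fun i => p i ≠ 0).card ≤ 15 * s + 12 := by
    rw [← hn]; exact Finset.card_le_univ _
  have hesum : ∑ h, e h = 6 := by omega
  have hdiv : ∀ q, 4 ∣ ∑ h with ip h q ≠ 0, e h := fun q => by
    have h1 : 4 ∣ ∑ h with ip h q ≠ 0, w h := by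
      simp only [hw, Finset.card_filter]
      rw [Finset.sum_comm]
      refine Finset.dvd_sum fun i _ => ?_
      rw [← Finset.card_filter, Finset.filter_filter]
      exact ip_count2 q (p i)
    have h2 : ∑ h with ip h q ≠ 0, w h =
        (if q = 0 then 0 else 8) * (8 * s + 6) + ∑ h with ip h q ≠ 0, e h := by
      rw [← ip_count1 q, ← smul_eq_mul, ← Finset.sum_const, ← Finset.sum_add_distrib]
      refine Finset.sum_congr rfl fun h hh => ?_
      have : h ≠ 0 := by
        rintro rfl
        exact (Finset.mem_filter.1 hh).2 (by simp [ip])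
      rw [hwe h, if_pos this]
    split_ifs at h2 <;> omega
  have hfin := supp_le e (by simp [he]) hesum hdiv
  have hsub : (Finset.univ.filter fun h : V4 => h ≠ 0) ⊆
      (Finset.univ.filter fun h => w h = 8 * s + 6) ∪ (Finset.univ.filter fun h => e h ≠ 0) := by
    intro h hh
    simp only [Finset.mem_filter, Finset.mem_univ, true_and, Finset.mem_union] at hh ⊢
    have := hwe h
    rw [if_pos hh] at this
    omega
  have := (Finset.card_le_card hsub).trans (Finset.card_union_le _ _)
  omega

lemma wtCount_range {ι : Type*} [Fintype ι] (G : V4 →ₗ[ZMod 2] (ι → ZMod 2))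
    (hG : Function.Injective G) (d : ℕ) :
    wtCount (LinearMap.range G) d = (Finset.univ.filter fun h => hammingNorm (G h) = d).card := by
  unfold wtCount
  have : {c : ι → ZMod 2 | c ∈ LinearMap.range G ∧ hammingNorm c = d} =
      G '' {h | hammingNorm (G h) = d} := by
    ext c
    constructor
    · rintro ⟨⟨h, rfl⟩, hh⟩
      exact ⟨h, hh, rfl⟩
    · rintro ⟨h, hh, rfl⟩
      exact ⟨⟨h, rfl⟩, hh⟩
  rw [this, Set.ncard_image_of_injective _ hG, ← Set.ncard_coe_finset]
  simp

/-- The code generated by the columns `p i`. -/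
def genMap {ι : Type*} (p : ι → V4) : V4 →ₗ[ZMod 2] (ι → ZMod 2) where
  toFun h := fun i => ip h (p i)
  map_add' a b := by funext i; simp [ip]; ring
  map_smul' a b := by funext i; simp [ip]; ring

/-- Points of PG(3,2); the last three form a line. -/
def pts (k : ℕ) : V4 :=
  let t := 15 - k % 15
  fun j => if t.testBit j.val then 1 else 0

set_option maxRecDepth 100000 in
lemma pts15 : ∀ h : V4, (∑ k ∈ Finset.range 15, if ip h (pts k) ≠ 0 then 1 else 0) =
    if h = 0 then 0 else 8 := by decide +kernel

set_option maxRecDepth 100000 in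
lemma pts12 : ∀ h : V4, h ≠ 0 → (∑ k ∈ Finset.range 12, if ip h (pts k) ≠ 0 then 1 else 0) =
    if h 0 = 0 ∧ h 1 = 0 then 8 else 6 := by decide +kernel

lemma ptsN (s : ℕ) (h : V4) (h0 : h ≠ 0) :
    (∑ k ∈ Finset.range (15 * s + 12), if ip h (pts k) ≠ 0 then 1 else 0) =
    8 * s + if h 0 = 0 ∧ h 1 = 0 then 8 else 6 := by
  induction s with
  | zero => simpa using pts12 h h0
  | succ s ih =>
    rw [show 15 * (s + 1) + 12 = 15 + (15 * s + 12) by ring, Finset.sum_range_add, pts15,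
      if_neg h0]
    have : ∀ k, pts (15 + k) = pts k := fun k => by simp [pts]
    simp only [this]
    rw [ih]; ring

/-- every `[15s+12, 4, 8s+6]_2` binary linear code has at least 12
minimum-weight codewords, and this bound is attained. -/
theorem stmt_18 (s : ℕ) :
    (∀ C : Submodule (ZMod 2) (Fin (15 * s + 12) → ZMod 2),
      Module.finrank (ZMod 2) C = 4 → minDistIs C (8 * s + 6) →
        12 ≤ wtCount C (8 * s + 6)) ∧
    (∃ C : Submodule (ZMod 2) (Fin (15 * s + 12) → ZMod 2),
      Module.finrank (ZMod 2) C = 4 ∧ minDistIs C (8 * s + 6) ∧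
        wtCount C (8 * s + 6) = 12) := by
  constructor
  · intro C hC hmin
    let b := Module.finBasisOfFinrankEq (ZMod 2) C hC
    let G : V4 →ₗ[ZMod 2] (Fin (15 * s + 12) → ZMod 2) :=
      C.subtype ∘ₗ (b.equivFun.symm : V4 →ₗ[ZMod 2] C)
    have hinj : Function.Injective G :=
      C.injective_subtype.comp b.equivFun.symm.injective
    have hr : LinearMap.range G = C := by
      rw [LinearMap.range_comp, LinearEquiv.range, Submodule.map_top, Submodule.range_subtype]
    have hcount := wtCount_range G hinj (8 * s + 6)
    rw [hr] at hcount
    rw [hcount]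
    refine core s (by simp) (fun i j => G (fun k => if j = k then 1 else 0) i) _ (fun h => ?_) (fun h h0 => ?_)
    · have : ∀ i, G h i = ip h (fun j => G (fun k => if j = k then 1 else 0) i) := fun i => by
        conv_lhs => rw [LinearMap.pi_apply_eq_sum_univ G h]
        simp only [Fin.sum_univ_four, ip, Pi.add_apply, Pi.smul_apply, smul_eq_mul]
      simp only [hammingNorm, this]
    · refine hmin.2 _ (hr ▸ LinearMap.mem_range_self G h) ?_
      intro h'
      exact h0 (hinj (by rw [h', map_zero]))
  · let G := genMap (fun i : Fin (15 * s + 12) => pts i.val)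
    have hwt : ∀ h, h ≠ 0 → hammingNorm (G h) = 8 * s + if h 0 = 0 ∧ h 1 = 0 then 8 else 6 := by
      intro h h0
      rw [← ptsN s h h0, Finset.sum_range, ← Finset.card_filter]
      rfl
    have hinj : Function.Injective G := by
      rw [injective_iff_map_eq_zero]
      intro h hh
      by_contra h0
      have := hwt h h0
      rw [hh, hammingNorm_zero] at this
      split_ifs at this <;> omega
    have hiff : ∀ h, hammingNorm (G h) = 8 * s + 6 ↔ ¬ (h 0 = 0 ∧ h 1 = 0) := by
      intro h
      by_cases h0 : h = 0
      · subst h0; simp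
      · rw [hwt h h0]
        split_ifs with hc <;> simp [hc]
    refine ⟨LinearMap.range G, ?_, ⟨?_, ?_⟩, ?_⟩
    · rw [LinearMap.finrank_range_of_inj hinj]; simp
    · refine ⟨G (Pi.single 0 1), ⟨_, rfl⟩, ?_, ?_⟩
      · intro h
        have := hinj (h.trans (map_zero G).symm)
        simp at this
      · rw [hiff]; simp
    · rintro _ ⟨h, rfl⟩ hne
      have h0 : h ≠ 0 := by
        rintro rfl
        exact hne (map_zero G)
      rw [hwt h h0]
      split_ifs <;> omega
    · rw [wtCount_range G hinj]
      simp only [hiff]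
      decide +kernel
end
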